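/- arXiv:1608.06039 — 2 statements merged into one kernel-verified Lean document; each statement's English description precedes it below -/
import Mathlib

section
/- Let V and W be representations of A_n-type quivers agreeing everywhere except at index i, related by an exact diamond at index i. Then there is a partial bijection between the interval decompositions of V and W: intervals I[i;i] on either side are unmatched; intervals I[b;i] of V with b < i are matched with intervals I[b;i−1] of W and vice versa; intervals I[i;d] of V with d > i are matched with intervals I[i+1;d] of W and vice versa; and in all other cases intervals I[b;d] are matched with identical intervals I[b;d]. -/
/-- A representation of an `A_{n+1}`-type quiver with vertices `0,…,n` and arrows
`i ↔ i+1` for `i : Fin n`, oriented forward when `orient i = true`. -/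
structure ZigzagRep (F : Type) [Field F] (n : ℕ) (orient : Fin n → Bool) where
  V : Fin (n + 1) → Type
  addgrp : ∀ i, AddCommGroup (V i) := by infer_instance
  mod : ∀ i, Module F (V i) := by infer_instance
  fwd : ∀ i : Fin n, orient i = true → (V i.castSucc →ₗ[F] V i.succ)
  bwd : ∀ i : Fin n, orient i = false → (V i.succ →ₗ[F] V i.castSucc)

attribute [instance] ZigzagRep.addgrp ZigzagRep.mod

variable {F : Type} [Field F] {n : ℕ} {orient : Fin n → Bool}

/-- Isomorphism of zigzag representations. -/
structure ZigzagRep.Iso (A B : ZigzagRep F n orient) where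
  e : ∀ i, A.V i ≃ₗ[F] B.V i
  comm_fwd : ∀ (i : Fin n) (h : orient i = true) (x : A.V i.castSucc),
    e i.succ (A.fwd i h x) = B.fwd i h (e i.castSucc x)
  comm_bwd : ∀ (i : Fin n) (h : orient i = false) (x : A.V i.succ),
    e i.castSucc (A.bwd i h x) = B.bwd i h (e i.succ x)

/-- The space at vertex `i` of the interval representation `I[b;d]`. -/
def intervalSp (F : Type) [Field F] (b d i : ℕ) : Submodule F F :=
  if b ≤ i ∧ i ≤ d then ⊤ else ⊥

open Classical in
/-- The interval representation `I[b;d]`. -/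
noncomputable def intervalRep (F : Type) [Field F] (n : ℕ) (orient : Fin n → Bool)
    (b d : ℕ) : ZigzagRep F n orient where
  V i := ↥(intervalSp F b d i)
  fwd i _ :=
    if h : intervalSp F b d i ≤ intervalSp F b d (i + 1) then Submodule.inclusion h else 0
  bwd i _ :=
    if h : intervalSp F b d (i + 1) ≤ intervalSp F b d i then Submodule.inclusion h else 0

/-- Direct sum of a family of zigzag representations. -/
noncomputable def ZigzagRep.dsum {ι : Type} [DecidableEq ι]
    (R : ι → ZigzagRep F n orient) : ZigzagRep F n orient where
  V i := Π₀ k, (R k).V i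
  fwd i h := DFinsupp.mapRange.linearMap fun k => (R k).fwd i h
  bwd i h := DFinsupp.mapRange.linearMap fun k => (R k).bwd i h

/-- Binary direct sum of two zigzag representations. -/
def ZigzagRep.prod (A B : ZigzagRep F n orient) : ZigzagRep F n orient where
  V i := A.V i × B.V i
  fwd i h := (A.fwd i h).prodMap (B.fwd i h)
  bwd i h := (A.bwd i h).prodMap (B.bwd i h)

/-- The matching rule of the exact diamond principle at index `i`: intervals `I[b;i]` are
matched with `I[b;i-1]` and vice versa (`b < i`), intervals `I[i;d]` with `I[i+1;d]` and
vice versa (`d > i`), and all other intervals are matched identically. -/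
def matchedInterval (i b d b' d' : ℕ) : Prop :=
  (b < i ∧ d = i ∧ b' = b ∧ d' = i - 1) ∨
  (b < i ∧ d + 1 = i ∧ b' = b ∧ d' = i) ∨
  (i < d ∧ b = i ∧ b' = i + 1 ∧ d' = d) ∨
  (i < d ∧ b = i + 1 ∧ b' = i ∧ d' = d) ∨
  (d ≠ i ∧ d + 1 ≠ i ∧ b ≠ i ∧ b ≠ i + 1 ∧ b' = b ∧ d' = d)

open Submodule in
/-- In a finite-dimensional space, a linearly independent set adapted to a chain of subspaces
extends, by vectors of a large enough subspace `K`, to a basis adapted to the chain. -/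
theorem exists_adapted_extension {E : Type} [AddCommGroup E] [Module F E]
    [FiniteDimensional F E] (K : Submodule F E) {S : Set (Submodule F E)}
    (hS : IsChain (· ≤ ·) S) (htop : ⊤ ∈ S) (B : Set E) (hB : LinearIndepOn F id B)
    (hadapt : ∀ U ∈ S, span F B ⊓ U ≤ span F (B ∩ U))
    (hK : ∀ U ∈ S, U ≤ (span F B ⊓ U) ⊔ (K ⊓ U)) :
    ∃ T : Set E, T ⊆ K ∧ Disjoint B T ∧ LinearIndepOn F id (B ∪ T) ∧
      span F (B ∪ T) = ⊤ ∧ ∀ U ∈ S, U ≤ span F ((B ∪ T) ∩ U) := by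
  induction h : span F B using WellFoundedGT.induction generalizing B with
  | ind P ih =>
  subst h
  by_cases hfull : span F B = ⊤
  · refine ⟨∅, by simp, by simp, by simpa using hB, by simpa using hfull, fun U hU ↦ ?_⟩
    simpa [hfull] using hadapt U hU
  have hne : {U | U ∈ S ∧ ¬ K ⊓ U ≤ span F B}.Nonempty := by
    refine ⟨⊤, htop, fun hle ↦ hfull (top_le_iff.1 ?_)⟩
    exact (hK ⊤ htop).trans (sup_le inf_le_left hle)
  obtain ⟨U₀, ⟨hU₀, hU₀B⟩, hmin⟩ := wellFounded_lt.has_min _ hne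
  obtain ⟨v, ⟨hvK, hvU₀⟩, hvB⟩ := SetLike.not_le_iff_exists.1 hU₀B
  have hlt : span F B < span F (insert v B) :=
    lt_of_le_of_ne (span_mono (Set.subset_insert _ _)) fun heq ↦
      hvB (heq ▸ subset_span (Set.mem_insert _ _))
  have hstep : ∀ U ∈ S, span F (insert v B) ⊓ U ≤ span F (insert v B ∩ U) := by
    intro U hU
    have hmono : span F (B ∩ U) ≤ span F (insert v B ∩ U) :=
      span_mono (Set.inter_subset_inter_left _ (Set.subset_insert _ _))
    rintro w ⟨hw, hwU⟩
    by_cases hvU : v ∈ U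
    · obtain ⟨a, z, hz, rfl⟩ := mem_span_insert.1 hw
      have hzU : z ∈ U := by simpa using U.sub_mem hwU (U.smul_mem a hvU)
      exact add_mem (smul_mem _ _ (subset_span ⟨Set.mem_insert _ _, hvU⟩))
        (hmono (hadapt U hU ⟨hz, hzU⟩))
    · have hUlt : U < U₀ := by
        rcases hS.total hU hU₀ with hle | hle
        · exact lt_of_le_of_ne hle fun heq ↦ hvU (heq ▸ hvU₀)
        · exact absurd (hle hvU₀) hvU
      have hKU : K ⊓ U ≤ span F B := by
        by_contra hcon
        exact hmin U ⟨hU, hcon⟩ hUlt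
      have hUB : U ≤ span F B := (hK U hU).trans (sup_le inf_le_left hKU)
      exact hmono (hadapt U hU ⟨hUB hwU, hwU⟩)
  obtain ⟨T, hTK, hdisj, hli, hspan, hT⟩ := ih _ hlt (insert v B) (hB.id_insert hvB) hstep
    (fun U hU ↦ (hK U hU).trans (sup_le_sup_right (inf_le_inf_right _ hlt.le) _)) rfl
  have hunion : insert v B ∪ T = B ∪ insert v T := by
    rw [Set.insert_union, Set.union_insert]
  rw [hunion] at hli hspan hT
  refine ⟨insert v T, Set.insert_subset hvK hTK, ?_, hli, hspan, hT⟩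
  rw [Set.disjoint_insert_left] at hdisj
  rw [Set.disjoint_insert_right]
  exact ⟨fun hv ↦ hvB (subset_span hv), hdisj.2⟩

open Submodule in
/-- A family adapted to the preimages under `f` of a chain of subspaces and to `ker f` is mapped
by `f`, up to zero vectors, to a family that extends to a basis adapted to the chain. -/
theorem exists_adapted_of_comap {E E' ι : Type} [AddCommGroup E] [Module F E] [AddCommGroup E']
    [Module F E'] [FiniteDimensional F E'] (f : E →ₗ[F] E') {u : ι → E} {A : Set ι}
    (hu : LinearIndepOn F u A) (hA : ∀ k ∉ A, u k = 0) {S : Set (Submodule F E')}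
    (hS : IsChain (· ≤ ·) S) (htop : ⊤ ∈ S)
    (hker : LinearMap.ker f ≤ span F (Set.range u ∩ LinearMap.ker f))
    (hadapt : ∀ U ∈ S, U.comap f ≤ span F (Set.range u ∩ U.comap f)) :
    ∃ (s : Set ι) (y : ι → E') (T : Set E'), s ⊆ A ∧ (∀ k ∉ s, y k = 0) ∧
      (∀ k, f (u k) = y k) ∧ LinearIndepOn F y s ∧ Disjoint (y '' s) T ∧
      LinearIndepOn F id (y '' s ∪ T) ∧ span F (y '' s ∪ T) = ⊤ ∧
      ∀ U ∈ S, U ≤ span F ((y '' s ∪ T) ∩ U) := by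
  set s : Set ι := {k | f (u k) ≠ 0} with hs
  have hsA : s ⊆ A := fun k hk ↦ by
    by_contra hkA
    exact hk (by rw [hA k hkA, map_zero])
  have hli : LinearIndepOn F (f ∘ u) s := by
    have hu' : LinearIndepOn F u (s ∪ A \ s) := by rwa [Set.union_sdiff_cancel hsA]
    refine (hu.mono hsA).map ?_
    rw [← Set.image_eq_range]
    refine ((linearIndepOn_union_iff Set.disjoint_sdiff_right).1 hu').2.2.mono_right ?_
    refine hker.trans (span_le.2 ?_)
    rintro _ ⟨⟨k, rfl⟩, hk⟩
    by_cases hkA : k ∈ A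
    · exact subset_span ⟨k, ⟨hkA, fun h ↦ h hk⟩, rfl⟩
    · rw [hA k hkA]
      exact zero_mem _
  have hB : ∀ U ∈ S, span F ((f ∘ u) '' s) ⊓ U ≤ span F ((f ∘ u) '' s ∩ U) := by
    rintro U hU w ⟨hw, hwU⟩
    obtain ⟨z, rfl⟩ : w ∈ LinearMap.range f := by
      refine span_le.2 ?_ hw
      rintro _ ⟨k, -, rfl⟩
      exact ⟨u k, rfl⟩
    have hz := mem_map_of_mem (f := f) (hadapt U hU hwU)
    rw [map_span] at hz
    refine span_le.2 ?_ hz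
    rintro _ ⟨_, ⟨⟨k, rfl⟩, hk⟩, rfl⟩
    by_cases hks : f (u k) = 0
    · rw [hks]
      exact zero_mem _
    · exact subset_span ⟨⟨k, hks, rfl⟩, hk⟩
  obtain ⟨T, -, hT⟩ := exists_adapted_extension ⊤ hS htop ((f ∘ u) '' s) hli.id_image hB
    fun U _ ↦ by simp
  exact ⟨s, f ∘ u, T, hsA, fun k hk ↦ not_not.1 hk, fun _ ↦ rfl, hli, hT⟩

open Submodule in
/-- A family adapted to the images under `g` of a chain of subspaces lifts, as far as it lies in
`range g`, to a family that extends by vectors of `ker g` to a basis adapted to the chain. -/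
theorem exists_adapted_of_map {E E' ι : Type} [AddCommGroup E] [Module F E] [AddCommGroup E']
    [Module F E'] [FiniteDimensional F E'] (g : E' →ₗ[F] E) {u : ι → E} {A : Set ι}
    (hu : LinearIndepOn F u A) (hA : ∀ k ∉ A, u k = 0) {S : Set (Submodule F E')}
    (hS : IsChain (· ≤ ·) S) (htop : ⊤ ∈ S)
    (hadapt : ∀ U ∈ S, U.map g ≤ span F (Set.range u ∩ U.map g)) :
    ∃ (s : Set ι) (y : ι → E') (T : Set E'), s ⊆ A ∧ (∀ k ∉ s, y k = 0) ∧
      (∀ k ∈ s, g (y k) = u k) ∧ T ⊆ LinearMap.ker g ∧ LinearIndepOn F y s ∧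
      Disjoint (y '' s) T ∧ LinearIndepOn F id (y '' s ∪ T) ∧ span F (y '' s ∪ T) = ⊤ ∧
      ∀ U ∈ S, U ≤ span F ((y '' s ∪ T) ∩ U) := by
  classical
  have hlift : ∀ k : {k // k ∈ A ∧ u k ∈ LinearMap.range g},
      ∃ v, g v = u k ∧ ∀ U ∈ S, u k ∈ U.map g → v ∈ U := by
    rintro ⟨k, -, v₀, hv₀⟩
    obtain ⟨U₀, ⟨hU₀, v, hv, hgv⟩, hmin⟩ := wellFounded_lt.has_min
      {U | U ∈ S ∧ u k ∈ U.map g} ⟨⊤, htop, v₀, trivial, hv₀⟩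
    refine ⟨v, hgv, fun U hU hkU ↦ ?_⟩
    rcases hS.total hU₀ hU with hle | hle
    · exact hle hv
    · rcases hle.eq_or_lt with heq | hlt
      · exact heq ▸ hv
      · exact absurd hlt (hmin U ⟨hU, hkU⟩)
  choose z hgz hz using hlift
  set s : Set ι := {k | k ∈ A ∧ u k ∈ LinearMap.range g} with hs
  let y : ι → E' := fun k ↦ if hk : k ∈ s then z ⟨k, hk⟩ else 0
  have hy0 : ∀ k ∉ s, y k = 0 := fun k hk ↦ dif_neg hk
  have hgy : ∀ k ∈ s, g (y k) = u k := fun k hk ↦ by simp only [y, dif_pos hk, hgz]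
  have hyU : ∀ k ∈ s, ∀ U ∈ S, u k ∈ U.map g → y k ∈ U := fun k hk ↦ by
    simpa only [y, dif_pos hk] using hz ⟨k, hk⟩
  have hsA : s ⊆ A := fun k hk ↦ hk.1
  have hgli : LinearIndepOn F (g ∘ y) s := (hu.mono hsA).congr fun k hk ↦ (hgy k hk).symm
  have hli : LinearIndepOn F y s := hgli.of_comp g
  have hdisj : Disjoint (span F (y '' s)) (LinearMap.ker g) := by
    rw [Set.image_eq_range]
    exact Submodule.range_ker_disjoint hgli
  have hmap : ∀ U ∈ S, ∀ w ∈ U, ∃ w' ∈ span F (y '' s ∩ U), g w' = g w := by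
    intro U hU w hw
    have hgw := hadapt U hU (mem_map_of_mem hw)
    suffices h : span F (Set.range u ∩ U.map g) ≤ (span F (y '' s ∩ U)).map g from h hgw
    refine span_le.2 ?_
    rintro _ ⟨⟨k, rfl⟩, hk⟩
    by_cases hkA : k ∈ A
    · have hks : k ∈ s := ⟨hkA, LinearMap.map_le_range hk⟩
      exact ⟨y k, subset_span ⟨⟨k, hks, rfl⟩, hyU k hks U hU hk⟩, hgy k hks⟩
    · rw [hA k hkA]
      exact zero_mem _
  have hB : ∀ U ∈ S, span F (y '' s) ⊓ U ≤ span F (y '' s ∩ U) := by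
    rintro U hU w ⟨hw, hwU⟩
    obtain ⟨w', hw', hgw⟩ := hmap U hU w hwU
    have hw's : w' ∈ span F (y '' s) := span_mono Set.inter_subset_left hw'
    have : w' - w = 0 := disjoint_def.1 hdisj _ (sub_mem hw's hw)
      (by rw [LinearMap.mem_ker, map_sub, hgw, sub_self])
    rwa [← sub_eq_zero.1 this]
  have hK : ∀ U ∈ S, U ≤ (span F (y '' s) ⊓ U) ⊔ (LinearMap.ker g ⊓ U) := by
    intro U hU w hw
    obtain ⟨w', hw', hgw⟩ := hmap U hU w hw
    have hw'U : w' ∈ U := span_le.2 Set.inter_subset_right hw'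
    refine mem_sup.2 ⟨w', ⟨span_mono Set.inter_subset_left hw', hw'U⟩, w - w', ⟨?_, ?_⟩, by simp⟩
    · simp [hgw]
    · exact sub_mem hw hw'U
  obtain ⟨T, hTK, hT⟩ :=
    exists_adapted_extension (LinearMap.ker g) hS htop (y '' s) hli.id_image hB hK
  exact ⟨s, y, T, hsA, hy0, hgy, hTK, hli, hT⟩

/-- The family `x` of sections of `R`, with `x k` supported on `[b k; d k]`, decomposes the
restriction of `R` to the vertices `0, …, t` into intervals. -/
structure ZigzagRep.IsIntervalBasis (R : ZigzagRep F n orient) (t : Fin (n + 1)) {ι : Type}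
    (b d : ι → ℕ) (x : ι → ∀ j, R.V j) : Prop where
  le : ∀ k, b k ≤ d k
  le_top : ∀ k, d k ≤ t
  zero : ∀ k (j : Fin (n + 1)), ¬(b k ≤ j ∧ j ≤ d k) → x k j = 0
  li : ∀ j ≤ t, LinearIndepOn F (fun k ↦ x k j) {k | b k ≤ j ∧ j ≤ d k}
  span : ∀ j ≤ t, Submodule.span F (Set.range fun k ↦ x k j) = ⊤
  fwd : ∀ (i : Fin n) (h : orient i = true), i.succ ≤ t → ∀ k, b k ≤ i → i ≤ d k →
    R.fwd i h (x k i.castSucc) = x k i.succ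
  bwd : ∀ (i : Fin n) (h : orient i = false), i.succ ≤ t → ∀ k, b k ≤ i + 1 → i + 1 ≤ d k →
    R.bwd i h (x k i.succ) = x k i.castSucc

theorem ZigzagRep.isIntervalBasis_zero (R : ZigzagRep F n orient) {T : Set (R.V 0)}
    (hli : LinearIndepOn F id T) (hspan : Submodule.span F T = ⊤) :
    R.IsIntervalBasis 0 (fun _ : T ↦ 0) (fun _ ↦ 0) (fun v ↦ Function.update 0 0 v.1) where
  le _ := le_rfl
  le_top _ := Nat.zero_le _
  zero k j hj := Function.update_of_ne (fun h ↦ hj (by simp [h])) _ _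
  li j hj := by
    obtain rfl := Fin.le_zero_iff.1 hj
    simpa [linearIndepOn_univ_iff] using hli.linearIndependent
  span j hj := by
    obtain rfl := Fin.le_zero_iff.1 hj
    simpa using hspan
  fwd i h hi := absurd hi (by simp)
  bwd i h hi := absurd hi (by simp)

open Classical Sum in
theorem ZigzagRep.IsIntervalBasis.extend {R : ZigzagRep F n orient} {i : Fin n} {ι : Type}
    {b d : ι → ℕ} {x : ι → ∀ j, R.V j} (hx : R.IsIntervalBasis i.castSucc b d x) {s : Set ι}
    (hs : s ⊆ {k | d k = i}) {y : ι → R.V i.succ} (hy0 : ∀ k ∉ s, y k = 0)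
    {T : Set (R.V i.succ)} (hy : LinearIndepOn F y s) (hdisj : Disjoint (y '' s) T)
    (hli : LinearIndepOn F id (y '' s ∪ T)) (hspan : Submodule.span F (y '' s ∪ T) = ⊤)
    (hfwd : ∀ h k, R.fwd i h (x k i.castSucc) = y k)
    (hbwd : ∀ h, ∀ k ∈ s, R.bwd i h (y k) = x k i.castSucc)
    (hbwdT : ∀ h, ∀ v ∈ T, R.bwd i h v = 0) :
    R.IsIntervalBasis i.succ (Sum.elim b fun _ : T ↦ (i : ℕ) + 1)
      (Sum.elim (fun k ↦ if k ∈ s then (i : ℕ) + 1 else d k) fun _ ↦ (i : ℕ) + 1)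
      (Sum.elim (fun k ↦ Function.update (x k) i.succ (y k))
        fun v ↦ Function.update 0 i.succ v.1) := by
  have hle : ∀ k, d k ≤ i := hx.le_top
  have hne : ∀ j : Fin (n + 1), (j : ℕ) ≤ i → j ≠ i.succ := by
    rintro j hj rfl
    simp at hj
  have hds : ∀ k (j : ℕ), j ≤ i → (j ≤ (if k ∈ s then (i : ℕ) + 1 else d k) ↔ j ≤ d k) := by
    intro k j hj
    split_ifs with hk
    · have : d k = i := hs hk
      omega
    · rfl
  have hcases : ∀ j : Fin (n + 1), j ≤ i.succ → (j : ℕ) ≤ i ∨ j = i.succ := by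
    intro j hj
    rw [Fin.le_def, Fin.val_succ] at hj
    rw [Fin.ext_iff, Fin.val_succ]
    omega
  refine ⟨?_, ?_, ?_, ?_, ?_, ?_, ?_⟩
  · rintro (k | v)
    · have := hx.le k
      have := hle k
      simp only [elim_inl]
      split_ifs <;> omega
    · exact le_rfl
  · rintro (k | v)
    · have := hle k
      simp only [elim_inl, Fin.val_succ]
      split_ifs <;> omega
    · exact le_rfl
  · rintro (k | v) j hj
    · simp only [elim_inl] at hj ⊢
      rcases eq_or_ne j i.succ with rfl | hji
      · rw [Function.update_self]
        refine hy0 k fun hk ↦ hj ?_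
        have := hx.le k
        have := hle k
        simp only [if_pos hk, Fin.val_succ]
        omega
      · rw [Function.update_of_ne hji]
        refine hx.zero k j fun hk ↦ hj ⟨hk.1, ?_⟩
        have := hle k
        exact (hds k j (by omega)).2 hk.2
    · refine Function.update_of_ne (fun h ↦ hj ?_) _ _
      simp [h]
  · intro j hj
    rcases hcases j hj with hji | rfl
    · have hset : {k : ι ⊕ T | Sum.elim b (fun _ : T ↦ (i : ℕ) + 1) k ≤ j ∧
          j ≤ Sum.elim (fun k ↦ if k ∈ s then (i : ℕ) + 1 else d k) (fun _ ↦ (i : ℕ) + 1) k} =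
          inl '' {k | b k ≤ j ∧ j ≤ d k} := by
        ext (k | v)
        · simp [hds k j hji]
        · simp; omega
      rw [hset]
      refine LinearIndepOn.image_of_comp _ _ ((hx.li j hji).congr fun k _ ↦ ?_)
      exact (Function.update_of_ne (hne j hji) _ _).symm
    · have hset : {k : ι ⊕ T | Sum.elim b (fun _ : T ↦ (i : ℕ) + 1) k ≤ i.succ ∧
          i.succ ≤ Sum.elim (fun k ↦ if k ∈ s then (i : ℕ) + 1 else d k)
            (fun _ ↦ (i : ℕ) + 1) k} = inl '' s ∪ Set.range inr := by
        ext (k | v)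
        · have := hx.le k
          have := hle k
          by_cases hk : k ∈ s <;> simp [hk] <;> omega
        · simp
      rw [hset, LinearIndepOn_iff_linearIndepOn_image_injOn]
      constructor
      · rw [Set.image_union, Set.image_image, ← Set.range_comp]
        simpa [Function.comp_def] using hli
      · rintro _ (⟨k, hk, rfl⟩ | ⟨v, rfl⟩) _ (⟨l, hl, rfl⟩ | ⟨w, rfl⟩) h <;>
          simp only [elim_inl, elim_inr, Function.update_self] at h
        · rw [hy.injOn hk hl h]
        · exact absurd w.2 (Set.disjoint_left.1 hdisj (h ▸ ⟨k, hk, rfl⟩))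
        · exact absurd v.2 (Set.disjoint_left.1 hdisj (h ▸ ⟨l, hl, rfl⟩))
        · rw [Subtype.ext h]
  · intro j hj
    rcases hcases j hj with hji | rfl
    · rw [eq_top_iff, ← hx.span j hji]
      refine Submodule.span_mono ?_
      rintro _ ⟨k, rfl⟩
      exact ⟨inl k, Function.update_of_ne (hne j hji) _ _⟩
    · rw [eq_top_iff, ← hspan]
      refine Submodule.span_mono (Set.union_subset ?_ fun v hv ↦ ?_)
      · rintro _ ⟨k, -, rfl⟩
        exact ⟨inl k, Function.update_self ..⟩
      · exact ⟨inr ⟨v, hv⟩, Function.update_self ..⟩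
  · rintro l h hl (k | v) hbk hdk
    · simp only [elim_inl] at hbk hdk ⊢
      rcases eq_or_ne l i with rfl | hli'
      · rw [Function.update_self, Function.update_of_ne (hne _ le_rfl), hfwd]
      · have hlt : (l : ℕ) < i := by
          have : (l : ℕ) ≤ i := by simpa using hl
          exact lt_of_le_of_ne this fun h ↦ hli' (Fin.ext h)
        rw [Function.update_of_ne (hne _ (by simp; omega)),
          Function.update_of_ne (hne _ (by simp; omega))]
        exact hx.fwd l h (by simpa [Fin.le_def] using hlt) k hbk ((hds k l hlt.le).1 hdk)
    · have : (l : ℕ) ≤ i := by simpa using hl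
      simp only [elim_inr] at hbk
      omega
  · rintro l h hl (k | v) hbk hdk
    · simp only [elim_inl] at hbk hdk ⊢
      rcases eq_or_ne l i with rfl | hli'
      · rw [Function.update_self, Function.update_of_ne (hne _ le_rfl)]
        refine hbwd h k ?_
        by_contra hk
        have := hle k
        rw [if_neg hk] at hdk
        omega
      · have hlt : (l : ℕ) < i := by
          have : (l : ℕ) ≤ i := by simpa using hl
          exact lt_of_le_of_ne this fun h ↦ hli' (Fin.ext h)
        rw [Function.update_of_ne (hne _ (by simp; omega)),
          Function.update_of_ne (hne _ (by simp; omega))]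
        exact hx.bwd l h (by simpa [Fin.le_def] using hlt) k hbk ((hds k _ hlt).1 hdk)
    · have hli' : l = i := by
        have : (l : ℕ) ≤ i := by simpa using hl
        simp only [elim_inr] at hbk
        exact Fin.ext (by omega)
      subst hli'
      simp only [elim_inr, Function.update_self]
      rw [Function.update_of_ne (hne _ le_rfl), hbwdT h v v.2, Pi.zero_apply]

theorem ZigzagRep.exists_isIntervalBasis_adapted (R : ZigzagRep F n orient)
    [∀ j, FiniteDimensional F (R.V j)] (t : Fin (n + 1)) :
    ∀ S : Set (Submodule F (R.V t)), IsChain (· ≤ ·) S →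
      ∃ (ι : Type) (_ : Finite ι) (b d : ι → ℕ) (x : ι → ∀ j, R.V j),
        R.IsIntervalBasis t b d x ∧
        ∀ U ∈ S, U ≤ Submodule.span F (Set.range (fun k ↦ x k t) ∩ U) := by
  induction t using Fin.induction with
  | zero =>
    intro S hS
    obtain ⟨T, -, -, hli, hspan, hT⟩ := exists_adapted_extension ⊤
      (hS.insert fun _ _ _ ↦ Or.inr le_top) (Set.mem_insert ⊤ S) ∅ (linearIndepOn_empty F id)
      (fun _ _ ↦ by simp) (fun _ _ ↦ by simp)
    rw [Set.empty_union] at hli hspan hT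
    refine ⟨T, hli.linearIndependent.setFinite, _, _, _, R.isIntervalBasis_zero hli hspan,
      fun U hU ↦ ?_⟩
    simpa using hT U (Set.mem_insert_of_mem _ hU)
  | succ i ih =>
    intro S hS
    have hS' : IsChain (· ≤ ·) (insert ⊤ S) := hS.insert fun _ _ _ ↦ Or.inr le_top
    have hactive : ∀ {ι : Type} {b d : ι → ℕ} {x : ι → ∀ j, R.V j},
        R.IsIntervalBasis i.castSucc b d x →
          LinearIndepOn F (fun k ↦ x k i.castSucc) {k | d k = i} ∧
          ∀ k ∉ {k | d k = i}, x k i.castSucc = 0 := by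
      intro ι b d x hx
      refine ⟨(hx.li _ le_rfl).mono fun k (hk : d k = i) ↦ ?_, fun k hk ↦ ?_⟩
      · exact ⟨hk ▸ hx.le k, hk.ge⟩
      · exact hx.zero k _ fun h ↦ hk (le_antisymm (hx.le_top k) h.2)
    cases ho : orient i with
    | true =>
      let f := R.fwd i ho
      obtain ⟨ι, hι, b, d, x, hx, had⟩ := ih (Submodule.comap f '' insert ⊥ (insert ⊤ S))
        ((hS'.insert fun _ _ _ ↦ Or.inl bot_le).image_of_map_rel _ _ _
          fun _ _ h ↦ Submodule.comap_mono h)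
      obtain ⟨hli, h0⟩ := hactive hx
      obtain ⟨s, y, T, hs, hy0, hfy, hy, hdisj, hBli, hspan, hT⟩ :=
        exists_adapted_of_comap f hli h0 hS' (Set.mem_insert ⊤ S)
          (had _ ⟨⊥, Set.mem_insert _ _, rfl⟩)
          (fun U hU ↦ had _ ⟨U, Set.mem_insert_of_mem _ hU, rfl⟩)
      have : Finite T := (hBli.mono Set.subset_union_right).linearIndependent.setFinite
      refine ⟨ι ⊕ T, inferInstance, _, _, _, hx.extend hs hy0 hy hdisj hBli hspan
        (fun _ ↦ hfy) (fun h ↦ by simp [ho] at h) (fun h ↦ by simp [ho] at h), fun U hU ↦ ?_⟩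
      refine (hT U (Set.mem_insert_of_mem _ hU)).trans (Submodule.span_mono ?_)
      refine Set.inter_subset_inter_left _ (Set.union_subset ?_ fun v hv ↦ ?_)
      · rintro _ ⟨k, -, rfl⟩
        exact ⟨Sum.inl k, Function.update_self ..⟩
      · exact ⟨Sum.inr ⟨v, hv⟩, Function.update_self ..⟩
    | false =>
      let g := R.bwd i ho
      obtain ⟨ι, hι, b, d, x, hx, had⟩ := ih (Submodule.map g '' insert ⊤ S)
        (hS'.image_of_map_rel _ _ _ fun _ _ h ↦ Submodule.map_mono h)
      obtain ⟨hli, h0⟩ := hactive hx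
      obtain ⟨s, y, T, hs, hy0, hgy, hTg, hy, hdisj, hBli, hspan, hT⟩ :=
        exists_adapted_of_map g hli h0 hS' (Set.mem_insert ⊤ S) (fun U hU ↦ had _ ⟨U, hU, rfl⟩)
      have : Finite T := (hBli.mono Set.subset_union_right).linearIndependent.setFinite
      refine ⟨ι ⊕ T, inferInstance, _, _, _, hx.extend hs hy0 hy hdisj hBli hspan
        (fun h ↦ by simp [ho] at h) (fun _ ↦ hgy) (fun _ v hv ↦ hTg hv), fun U hU ↦ ?_⟩
      refine (hT U (Set.mem_insert_of_mem _ hU)).trans (Submodule.span_mono ?_)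
      refine Set.inter_subset_inter_left _ (Set.union_subset ?_ fun v hv ↦ ?_)
      · rintro _ ⟨k, -, rfl⟩
        exact ⟨Sum.inl k, Function.update_self ..⟩
      · exact ⟨Sum.inr ⟨v, hv⟩, Function.update_self ..⟩

theorem ZigzagRep.IsIntervalBasis.reindex {R : ZigzagRep F n orient} {t : Fin (n + 1)}
    {ι κ : Type} {b d : ι → ℕ} {x : ι → ∀ j, R.V j} (hx : R.IsIntervalBasis t b d x)
    (σ : κ ≃ ι) : R.IsIntervalBasis t (b ∘ σ) (d ∘ σ) (x ∘ σ) where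
  le k := hx.le _
  le_top k := hx.le_top _
  zero k := hx.zero _
  li j hj := LinearIndepOn.comp_of_image (f := σ)
    ((hx.li j hj).mono (by rintro _ ⟨k, hk, rfl⟩; exact hk)) σ.injective.injOn
  span j hj := by
    rw [← hx.span j hj, ← σ.surjective.range_comp]
    rfl
  fwd i h hi k := hx.fwd i h hi _
  bwd i h hi k := hx.bwd i h hi _

/-- **Gabriel's theorem** in type `A`: every finite-dimensional zigzag representation decomposes
into intervals. -/
theorem ZigzagRep.exists_isIntervalBasis (R : ZigzagRep F n orient)
    [∀ j, FiniteDimensional F (R.V j)] :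
    ∃ (N : ℕ) (b d : Fin N → ℕ) (x : Fin N → ∀ j, R.V j),
      R.IsIntervalBasis (Fin.last n) b d x := by
  obtain ⟨ι, _, b, d, x, hx, -⟩ :=
    R.exists_isIntervalBasis_adapted (Fin.last n) ∅ IsChain.empty
  exact ⟨Nat.card ι, _, _, _, hx.reindex (Finite.equivFin ι).symm⟩

theorem ZigzagRep.IsIntervalBasis.eq_zero_of_sum {R : ZigzagRep F n orient} {t : Fin (n + 1)}
    {ι : Type} [Fintype ι] {b d : ι → ℕ} {x : ι → ∀ j, R.V j} (hx : R.IsIntervalBasis t b d x)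
    {j : Fin (n + 1)} (hj : j ≤ t) {a : ι → F} (ha : ∑ k, a k • x k j = 0) {k : ι}
    (hb : b k ≤ j) (hd : j ≤ d k) : a k = 0 := by
  classical
  set s : Finset ι := {k | b k ≤ j ∧ j ≤ d k} with hs
  refine linearIndepOn_iff'.1 (hx.li j hj) s a (by simp [hs]) ?_ k (by simp [hs, hb, hd])
  rw [← ha]
  refine Finset.sum_subset s.subset_univ fun k _ hk ↦ ?_
  rw [hx.zero k j (by simpa [hs] using hk), smul_zero]

theorem ZigzagRep.IsIntervalBasis.exists_sum_eq {R : ZigzagRep F n orient} {t : Fin (n + 1)}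
    {ι : Type} [Fintype ι] {b d : ι → ℕ} {x : ι → ∀ j, R.V j} (hx : R.IsIntervalBasis t b d x)
    {j : Fin (n + 1)} (hj : j ≤ t) (v : R.V j) :
    ∃ a : ι → F, (∀ k, ¬(b k ≤ j ∧ j ≤ d k) → a k = 0) ∧ ∑ k, a k • x k j = v := by
  classical
  have hv : v ∈ Submodule.span F (Set.range fun k ↦ x k j) := hx.span j hj ▸ Submodule.mem_top
  obtain ⟨a, rfl⟩ := (Submodule.mem_span_range_iff_exists_fun F).1 hv
  refine ⟨fun k ↦ if b k ≤ j ∧ j ≤ d k then a k else 0, fun k hk ↦ if_neg hk,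
    Finset.sum_congr rfl fun k _ ↦ ?_⟩
  by_cases hk : b k ≤ j ∧ j ≤ d k
  · simp only [if_pos hk]
  · rw [hx.zero k j hk, smul_zero, smul_zero]

theorem intervalSp_eq_top {b d i : ℕ} (h : b ≤ i ∧ i ≤ d) : intervalSp F b d i = ⊤ := if_pos h

/-- The coefficients of an element of a direct sum of interval representations. -/
def intervalCoeff {N : ℕ} {b d : Fin N → ℕ} {j : Fin (n + 1)}
    (c : (ZigzagRep.dsum fun k ↦ intervalRep F n orient (b k) (d k)).V j) (k : Fin N) : F :=
  ((show Π₀ k, intervalSp F (b k) (d k) j from c) k : intervalSp F (b k) (d k) j)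

section intervalCoeff

variable {N : ℕ} {b d : Fin N → ℕ}

theorem intervalCoeff_injective {j : Fin (n + 1)}
    {c c' : (ZigzagRep.dsum fun k ↦ intervalRep F n orient (b k) (d k)).V j}
    (h : ∀ k, intervalCoeff c k = intervalCoeff c' k) : c = c' :=
  DFinsupp.ext (β := fun k ↦ intervalSp F (b k) (d k) j) fun k ↦ Subtype.ext (h k)

theorem intervalCoeff_eq_zero {j : Fin (n + 1)}
    (c : (ZigzagRep.dsum fun k ↦ intervalRep F n orient (b k) (d k)).V j) {k : Fin N}
    (h : ¬(b k ≤ j ∧ j ≤ d k)) : intervalCoeff c k = 0 := by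
  have hmem : intervalCoeff c k ∈ intervalSp F (b k) (d k) j := Subtype.prop _
  have hbot : intervalSp F (b k) (d k) j = ⊥ := if_neg h
  rwa [hbot, Submodule.mem_bot] at hmem

theorem exists_intervalCoeff_eq (orient : Fin n → Bool) {j : Fin (n + 1)} {a : Fin N → F}
    (ha : ∀ k, ¬(b k ≤ j ∧ j ≤ d k) → a k = 0) :
    ∃ c : (ZigzagRep.dsum fun k ↦ intervalRep F n orient (b k) (d k)).V j,
      ∀ k, intervalCoeff c k = a k := by
  have hmem : ∀ k, a k ∈ intervalSp F (b k) (d k) j := by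
    intro k
    by_cases hk : b k ≤ j ∧ j ≤ d k
    · exact intervalSp_eq_top (F := F) hk ▸ Submodule.mem_top
    · exact ha k hk ▸ zero_mem _
  exact ⟨DFinsupp.equivFunOnFintype.symm fun k ↦ (⟨a k, hmem k⟩ : intervalSp F (b k) (d k) j),
    fun _ ↦ rfl⟩

theorem intervalCoeff_fwd {i : Fin n} (h : orient i = true)
    (c : (ZigzagRep.dsum fun k ↦ intervalRep F n orient (b k) (d k)).V i.castSucc) {k : Fin N}
    (hk : b k ≤ (i : ℕ) + 1 ∧ (i : ℕ) + 1 ≤ d k) :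
    intervalCoeff ((ZigzagRep.dsum fun k ↦ intervalRep F n orient (b k) (d k)).fwd i h c) k =
      intervalCoeff c k := by
  have hle : intervalSp F (b k) (d k) i ≤ intervalSp F (b k) (d k) (i + 1) :=
    (intervalSp_eq_top (F := F) hk).symm ▸ le_top
  have hincl : (intervalRep F n orient (b k) (d k)).fwd i h = Submodule.inclusion hle :=
    dif_pos hle
  exact congrArg (fun g : intervalSp F (b k) (d k) i →ₗ[F] intervalSp F (b k) (d k) (i + 1) ↦
    (g ((show Π₀ k, intervalSp F (b k) (d k) i from c) k) : F)) hincl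

theorem intervalCoeff_bwd {i : Fin n} (h : orient i = false)
    (c : (ZigzagRep.dsum fun k ↦ intervalRep F n orient (b k) (d k)).V i.succ) {k : Fin N}
    (hk : b k ≤ (i : ℕ) ∧ (i : ℕ) ≤ d k) :
    intervalCoeff ((ZigzagRep.dsum fun k ↦ intervalRep F n orient (b k) (d k)).bwd i h c) k =
      intervalCoeff c k := by
  have hle : intervalSp F (b k) (d k) (i + 1) ≤ intervalSp F (b k) (d k) i :=
    (intervalSp_eq_top (F := F) hk).symm ▸ le_top
  have hincl : (intervalRep F n orient (b k) (d k)).bwd i h = Submodule.inclusion hle :=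
    dif_pos hle
  exact congrArg (fun g : intervalSp F (b k) (d k) (i + 1) →ₗ[F] intervalSp F (b k) (d k) i ↦
    (g ((show Π₀ k, intervalSp F (b k) (d k) (i + 1) from c) k) : F)) hincl

/-- The linear map from the direct sum of intervals determined by a family of sections. -/
noncomputable def ZigzagRep.ofSections (R : ZigzagRep F n orient) (b d : Fin N → ℕ)
    (x : Fin N → ∀ j, R.V j) (j : Fin (n + 1)) :
    (dsum fun k ↦ intervalRep F n orient (b k) (d k)).V j →ₗ[F] R.V j where
  toFun c := ∑ k, intervalCoeff c k • x k j
  map_add' c c' := by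
    rw [← Finset.sum_add_distrib]
    exact Finset.sum_congr rfl fun k _ ↦ add_smul (intervalCoeff c k) (intervalCoeff c' k) _
  map_smul' r c := by
    rw [RingHom.id_apply, Finset.smul_sum]
    exact Finset.sum_congr rfl fun k _ ↦ mul_smul r (intervalCoeff c k) _

theorem ZigzagRep.ofSections_apply (R : ZigzagRep F n orient) (x : Fin N → ∀ j, R.V j)
    {j : Fin (n + 1)} (c : (dsum fun k ↦ intervalRep F n orient (b k) (d k)).V j) :
    R.ofSections b d x j c = ∑ k, intervalCoeff c k • x k j :=
  rfl

theorem ZigzagRep.IsIntervalBasis.bijective_ofSections {R : ZigzagRep F n orient}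
    {x : Fin N → ∀ j, R.V j} (hx : R.IsIntervalBasis (Fin.last n) b d x) (j : Fin (n + 1)) :
    Function.Bijective (R.ofSections b d x j) := by
  constructor
  · rw [injective_iff_map_eq_zero]
    intro c hc
    refine intervalCoeff_injective fun k ↦ ?_
    by_cases hk : b k ≤ j ∧ j ≤ d k
    · exact hx.eq_zero_of_sum (Fin.le_last j) hc hk.1 hk.2
    · rw [intervalCoeff_eq_zero _ hk, intervalCoeff_eq_zero _ hk]
  · intro v
    obtain ⟨a, ha, rfl⟩ := hx.exists_sum_eq (Fin.le_last j) v
    obtain ⟨c, hc⟩ := exists_intervalCoeff_eq orient ha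
    exact ⟨c, by simp only [ofSections_apply, hc]⟩

/-- An interval basis induces an isomorphism with a direct sum of interval representations. -/
noncomputable def ZigzagRep.IsIntervalBasis.iso {R : ZigzagRep F n orient}
    {x : Fin N → ∀ j, R.V j} (hx : R.IsIntervalBasis (Fin.last n) b d x) :
    ZigzagRep.Iso R (dsum fun k ↦ intervalRep F n orient (b k) (d k)) where
  e j := (LinearEquiv.ofBijective _ (hx.bijective_ofSections j)).symm
  comm_fwd i h v := by
    obtain ⟨c, rfl⟩ := (hx.bijective_ofSections i.castSucc).2 v
    rw [LinearEquiv.symm_apply_eq, LinearEquiv.ofBijective_symm_apply_apply,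
      LinearEquiv.ofBijective_apply, ofSections_apply, ofSections_apply, map_sum]
    refine Finset.sum_congr rfl fun k _ ↦ ?_
    rw [map_smul]
    by_cases hk : b k ≤ i ∧ i ≤ d k
    · rw [hx.fwd i h (Fin.le_last _) k hk.1 hk.2]
      by_cases hk' : b k ≤ (i : ℕ) + 1 ∧ (i : ℕ) + 1 ≤ d k
      · rw [intervalCoeff_fwd h c hk']
      · rw [hx.zero k i.succ hk', smul_zero, smul_zero]
    · rw [intervalCoeff_eq_zero c hk, zero_smul]
      by_cases hk' : b k ≤ (i : ℕ) + 1 ∧ (i : ℕ) + 1 ≤ d k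
      · rw [intervalCoeff_fwd h c hk', intervalCoeff_eq_zero c hk, zero_smul]
      · rw [hx.zero k i.succ hk', smul_zero]
  comm_bwd i h v := by
    obtain ⟨c, rfl⟩ := (hx.bijective_ofSections i.succ).2 v
    rw [LinearEquiv.symm_apply_eq, LinearEquiv.ofBijective_symm_apply_apply,
      LinearEquiv.ofBijective_apply, ofSections_apply, ofSections_apply, map_sum]
    refine Finset.sum_congr rfl fun k _ ↦ ?_
    rw [map_smul]
    by_cases hk : b k ≤ (i : ℕ) + 1 ∧ (i : ℕ) + 1 ≤ d k
    · rw [hx.bwd i h (Fin.le_last _) k hk.1 hk.2]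
      by_cases hk' : b k ≤ i ∧ i ≤ d k
      · rw [intervalCoeff_bwd h c hk']
      · rw [hx.zero k i.castSucc hk', smul_zero, smul_zero]
    · rw [intervalCoeff_eq_zero c hk, zero_smul]
      by_cases hk' : b k ≤ i ∧ i ≤ d k
      · rw [intervalCoeff_bwd h c hk', intervalCoeff_eq_zero c hk, zero_smul]
      · rw [hx.zero k i.castSucc hk', smul_zero]

end intervalCoeff

/-- In an exact diamond, adapted bases of the other three corners induce a linearly independent
family in the fourth one. -/
theorem linearIndepOn_of_exact_diamond {X Y Z W ι : Type} [Fintype ι] [AddCommGroup X]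
    [Module F X] [AddCommGroup Y] [Module F Y] [AddCommGroup Z] [Module F Z] [AddCommGroup W]
    [Module F W] {a : Z →ₗ[F] X} {c : Z →ₗ[F] Y} {p : X →ₗ[F] W} {q : Y →ₗ[F] W}
    (hexact : ∀ x y, p x = q y → ∃ z, a z = x ∧ c z = y)
    {A M C : Set ι} {x : ι → X} {y : ι → Y} {z : ι → Z}
    (hx : ∀ α : ι → F, ∑ k, α k • x k = 0 → ∀ k ∈ A, α k = 0)
    (hy : ∀ α : ι → F, ∑ k, α k • y k = 0 → ∀ k ∈ C, α k = 0)
    (hz : ∀ v, ∃ γ : ι → F, (∀ k ∉ M, γ k = 0) ∧ ∑ k, γ k • z k = v)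
    (ha : ∀ k ∈ M, a (z k) = x k) (hc : ∀ k ∈ M, c (z k) = y k) {w : ι → W}
    (hwA : ∀ k ∈ A, w k = p (x k)) (hwC : ∀ k ∉ A, w k = q (y k)) :
    LinearIndepOn F w {k | (k ∈ A ∨ k ∈ C) ∧ (k ∈ M → k ∈ A ∧ k ∈ C)} := by
  classical
  rw [linearIndepOn_iff'']
  intro t α hts hα0 hsum k hkt
  have hsum' : p (∑ k, (if k ∈ A then α k else 0) • x k) =
      q (∑ k, (if k ∈ A then 0 else -α k) • y k) := by
    rw [← sub_eq_zero, map_sum, map_sum, ← Finset.sum_sub_distrib, ← hsum,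
      ← Finset.sum_subset t.subset_univ fun k _ hk ↦ by simp [hα0 k hk]]
    refine Finset.sum_congr rfl fun k _ ↦ ?_
    by_cases hk : k ∈ A
    · simp [hk, hwA k hk]
    · simp [hk, hwC k hk]
  obtain ⟨v, hav, hcv⟩ := hexact _ _ hsum'
  obtain ⟨γ, hγ, rfl⟩ := hz v
  have himage : ∀ {E : Type} [AddCommGroup E] [Module F E] (f : Z →ₗ[F] E) {u : ι → E},
      (∀ k ∈ M, f (z k) = u k) → f (∑ k, γ k • z k) = ∑ k, γ k • u k := by
    intro E _ _ f u hfu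
    rw [map_sum]
    refine Finset.sum_congr rfl fun k _ ↦ ?_
    by_cases hk : k ∈ M
    · rw [map_smul, hfu k hk]
    · rw [hγ k hk, zero_smul, zero_smul, map_zero]
  rw [himage a ha, ← sub_eq_zero, ← Finset.sum_sub_distrib] at hav
  rw [himage c hc, ← sub_eq_zero, ← Finset.sum_sub_distrib] at hcv
  simp only [← sub_smul] at hav hcv
  obtain ⟨hAC, hMAC⟩ := hts hkt
  by_cases hkA : k ∈ A
  · have h1 : γ k - α k = 0 := by simpa [hkA] using hx _ hav k hkA
    rw [← sub_eq_zero.1 h1]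
    by_cases hkM : k ∈ M
    · simpa [hkA] using hy _ hcv k (hMAC hkM).2
    · exact hγ k hkM
  · have hkM : k ∉ M := fun h ↦ hkA (hMAC h).1
    simpa [hkA, hγ k hkM] using hy _ hcv k (hAC.resolve_left hkA)

/-- The left endpoint matched with `b` by the exact diamond principle at index `i`. -/
def matchedLeft (i b : ℕ) : ℕ := if b = i then i + 1 else if b = i + 1 then i else b

/-- The right endpoint matched with `d` by the exact diamond principle at index `i`. -/
def matchedRight (i d : ℕ) : ℕ := if d = i then i - 1 else if d + 1 = i then i else d

theorem matchedLeft_le_iff {i b j : ℕ} (hj : j ≠ i) : matchedLeft i b ≤ j ↔ b ≤ j := by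
  unfold matchedLeft
  split_ifs <;> omega

theorem le_matchedRight_iff {i d j : ℕ} (hj : j ≠ i) : j ≤ matchedRight i d ↔ j ≤ d := by
  unfold matchedRight
  split_ifs <;> omega

theorem matched_self_iff {m b d : ℕ} (hbd : b ≤ d) :
    (matchedLeft (m + 1) b ≤ m + 1 ∧ m + 1 ≤ matchedRight (m + 1) d) ↔
      ((b ≤ m ∧ m ≤ d) ∨ (b ≤ m + 2 ∧ m + 2 ≤ d)) ∧
      (b ≤ m + 1 ∧ m + 1 ≤ d → (b ≤ m ∧ m ≤ d) ∧ (b ≤ m + 2 ∧ m + 2 ≤ d)) := by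
  unfold matchedLeft matchedRight
  split_ifs <;> omega

theorem matchedLeft_le_matchedRight {m b d : ℕ} (hbd : b ≤ d) (hne : ¬(b = m + 1 ∧ d = m + 1)) :
    matchedLeft (m + 1) b ≤ matchedRight (m + 1) d := by
  unfold matchedLeft matchedRight
  split_ifs <;> omega

theorem matchedInterval_matched {m b d : ℕ} (hbd : b ≤ d) (hne : ¬(b = m + 1 ∧ d = m + 1)) :
    matchedInterval (m + 1) b d (matchedLeft (m + 1) b) (matchedRight (m + 1) d) := by
  unfold matchedLeft matchedRight matchedInterval
  split_ifs <;> omega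

theorem not_matched_eq {m b d : ℕ} (hbd : b ≤ d) :
    ¬(matchedLeft (m + 1) b = m + 1 ∧ matchedRight (m + 1) d = m + 1) := by
  unfold matchedLeft matchedRight
  split_ifs <;> omega

open Classical Sum in
/-- An interval basis at the top of an exact diamond yields one at the bottom, with matched
intervals and further intervals concentrated at the index of the diamond. -/
theorem ZigzagRep.IsIntervalBasis.exists_of_exact_diamond {m : ℕ} (hm : m + 1 < n)
    {orient' : Fin n → Bool}
    (horA : orient ⟨m, Nat.lt_of_succ_lt hm⟩ = false) (horC : orient ⟨m + 1, hm⟩ = true)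
    (horA' : orient' ⟨m, Nat.lt_of_succ_lt hm⟩ = true) (horC' : orient' ⟨m + 1, hm⟩ = false)
    (hsame : ∀ k : Fin n, (k : ℕ) ≠ m → (k : ℕ) ≠ m + 1 → orient' k = orient k)
    {VRep : ZigzagRep F n orient} {WRep : ZigzagRep F n orient'}
    [∀ j, FiniteDimensional F (WRep.V j)]
    (e : ∀ j : Fin (n + 1), (j : ℕ) ≠ m + 1 → (VRep.V j ≃ₗ[F] WRep.V j))
    (hcomm_fwd : ∀ (k : Fin n) (_ : (k : ℕ) ≠ m) (_ : (k : ℕ) ≠ m + 1)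
      (h : orient k = true) (h' : orient' k = true)
      (hs : ((k.succ : Fin (n + 1)) : ℕ) ≠ m + 1)
      (hc : ((k.castSucc : Fin (n + 1)) : ℕ) ≠ m + 1) (x : VRep.V k.castSucc),
        e k.succ hs (VRep.fwd k h x) = WRep.fwd k h' (e k.castSucc hc x))
    (hcomm_bwd : ∀ (k : Fin n) (_ : (k : ℕ) ≠ m) (_ : (k : ℕ) ≠ m + 1)
      (h : orient k = false) (h' : orient' k = false)
      (hs : ((k.succ : Fin (n + 1)) : ℕ) ≠ m + 1)
      (hc : ((k.castSucc : Fin (n + 1)) : ℕ) ≠ m + 1) (x : VRep.V k.succ),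
        e k.castSucc hc (VRep.bwd k h x) = WRep.bwd k h' (e k.succ hs x))
    (hexact :
      LinearMap.range
        (LinearMap.prod (VRep.bwd ⟨m, Nat.lt_of_succ_lt hm⟩ horA) (VRep.fwd ⟨m + 1, hm⟩ horC))
      = LinearMap.ker
        (LinearMap.coprod
          ((WRep.fwd ⟨m, Nat.lt_of_succ_lt hm⟩ horA') ∘ₗ
            (e (Fin.castSucc ⟨m, Nat.lt_of_succ_lt hm⟩) (by simp)).toLinearMap)
          (-((WRep.bwd ⟨m + 1, hm⟩ horC') ∘ₗ
            (e (Fin.succ ⟨m + 1, hm⟩) (by simp)).toLinearMap))))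
    {ι : Type} [Fintype ι] {b d : ι → ℕ} {x : ι → ∀ j, VRep.V j}
    (hx : VRep.IsIntervalBasis (Fin.last n) b d x) :
    ∃ (T : Type) (_ : Finite T)
      (w : {k // ¬(b k = m + 1 ∧ d k = m + 1)} ⊕ T → ∀ j, WRep.V j),
      WRep.IsIntervalBasis (Fin.last n)
        (Sum.elim (fun k : {k // ¬(b k = m + 1 ∧ d k = m + 1)} ↦
          matchedLeft (m + 1) (b k)) fun _ ↦ m + 1)
        (Sum.elim (fun k : {k // ¬(b k = m + 1 ∧ d k = m + 1)} ↦
          matchedRight (m + 1) (d k)) fun _ ↦ m + 1) w := by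
  let j₀ : Fin (n + 1) := Fin.castSucc ⟨m + 1, hm⟩
  let jl : Fin (n + 1) := Fin.castSucc ⟨m, Nat.lt_of_succ_lt hm⟩
  let jr : Fin (n + 1) := Fin.succ ⟨m + 1, hm⟩
  have hj₀ : ∀ j : Fin (n + 1), (j : ℕ) = m + 1 ↔ j = j₀ := fun j ↦ by simp [j₀, Fin.ext_iff]
  let a : VRep.V j₀ →ₗ[F] VRep.V jl := VRep.bwd ⟨m, Nat.lt_of_succ_lt hm⟩ horA
  let c : VRep.V j₀ →ₗ[F] VRep.V jr := VRep.fwd ⟨m + 1, hm⟩ horC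
  let p : VRep.V jl →ₗ[F] WRep.V j₀ :=
    WRep.fwd ⟨m, Nat.lt_of_succ_lt hm⟩ horA' ∘ₗ (e jl (by simp [jl])).toLinearMap
  let q : VRep.V jr →ₗ[F] WRep.V j₀ :=
    WRep.bwd ⟨m + 1, hm⟩ horC' ∘ₗ (e jr (by simp [jr])).toLinearMap
  have hex : ∀ u v, p u = q v ↔ ∃ z, a z = u ∧ c z = v := by
    intro u v
    have h := SetLike.ext_iff.1 hexact (u, v)
    rw [LinearMap.mem_range, LinearMap.mem_ker, LinearMap.coprod_apply, LinearMap.neg_apply,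
      ← sub_eq_add_neg, sub_eq_zero] at h
    refine h.symm.trans (exists_congr fun z ↦ ?_)
    rw [LinearMap.prod_apply]
    exact Prod.ext_iff
  have ha : ∀ k, b k ≤ m + 1 ∧ m + 1 ≤ d k → a (x k j₀) = x k jl := fun k hk ↦
    hx.bwd ⟨m, Nat.lt_of_succ_lt hm⟩ horA (Fin.le_last _) k hk.1 hk.2
  have hc : ∀ k, b k ≤ m + 1 ∧ m + 1 ≤ d k → c (x k j₀) = x k jr := fun k hk ↦
    hx.fwd ⟨m + 1, hm⟩ horC (Fin.le_last _) k hk.1 hk.2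
  have hpq : ∀ k, b k ≤ m + 1 ∧ m + 1 ≤ d k → p (x k jl) = q (x k jr) := fun k hk ↦
    (hex _ _).2 ⟨_, ha k hk, hc k hk⟩
  let u : ι → WRep.V j₀ := fun k ↦ if b k ≤ m ∧ m ≤ d k then p (x k jl) else q (x k jr)
  have hu_li := linearIndepOn_of_exact_diamond (fun u v ↦ (hex u v).1)
    (A := {k | b k ≤ m ∧ m ≤ d k}) (M := {k | b k ≤ m + 1 ∧ m + 1 ≤ d k})
    (C := {k | b k ≤ m + 2 ∧ m + 2 ≤ d k})
    (fun α hα k hk ↦ hx.eq_zero_of_sum (Fin.le_last jl) hα hk.1 hk.2)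
    (fun α hα k hk ↦ hx.eq_zero_of_sum (Fin.le_last jr) hα hk.1 hk.2)
    (hx.exists_sum_eq (Fin.le_last j₀)) ha hc
    (w := u) (fun k hk ↦ if_pos hk) (fun k hk ↦ if_neg hk)
  have hul : ∀ k, b k ≤ m ∧ m ≤ d k → u k = p (x k jl) := fun k hk ↦ if_pos hk
  have hur : ∀ k, b k ≤ m + 2 ∧ m + 2 ≤ d k → u k = q (x k jr) := by
    intro k hk
    by_cases hkl : b k ≤ m ∧ m ≤ d k
    · rw [hul k hkl, hpq k (by omega)]
    · exact if_neg hkl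
  have hu0 : ∀ k, ¬(((b k ≤ m ∧ m ≤ d k) ∨ (b k ≤ m + 2 ∧ m + 2 ≤ d k)) ∧
      (b k ≤ m + 1 ∧ m + 1 ≤ d k → (b k ≤ m ∧ m ≤ d k) ∧ (b k ≤ m + 2 ∧ m + 2 ≤ d k))) →
      u k = 0 := by
    intro k hk
    by_cases hkl : b k ≤ m ∧ m ≤ d k
    · rw [hul k hkl, hpq k (by omega), hx.zero k jr, map_zero]
      change ¬(b k ≤ m + 2 ∧ m + 2 ≤ d k)
      omega
    · rw [show u k = q (x k jr) from if_neg hkl]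
      by_cases hkr : b k ≤ m + 2 ∧ m + 2 ≤ d k
      · rw [← hpq k (by omega), hx.zero k jl hkl, map_zero]
      · rw [hx.zero k jr hkr, map_zero]
  let κ := {k // ¬(b k = m + 1 ∧ d k = m + 1)}
  set s : Set κ := {k | matchedLeft (m + 1) (b k) ≤ m + 1 ∧ m + 1 ≤ matchedRight (m + 1) (d k)}
    with hs
  have hact : ∀ k : κ, k ∈ s ↔ _ := fun k ↦ matched_self_iff (hx.le k)
  have hκ_li : LinearIndepOn F (fun k : κ ↦ u k) s :=
    LinearIndepOn.comp_of_image (f := Subtype.val)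
      (hu_li.mono (by rintro _ ⟨k, hk, rfl⟩; exact (hact k).1 hk)) Subtype.val_injective.injOn
  have hκ0 : ∀ k : κ, k ∉ s → u k = 0 := fun k hk ↦ hu0 k fun h ↦ hk ((hact k).2 h)
  obtain ⟨T, -, hdisj, hBli, hBspan, -⟩ := exists_adapted_extension ⊤ (S := {⊤})
    (Set.subsingleton_singleton.isChain) rfl ((fun k : κ ↦ u k) '' s) hκ_li.id_image
    (by simp) (by simp)
  let w : κ ⊕ T → ∀ j, WRep.V j := Sum.elim
    (fun k ↦ Function.update
      (fun j ↦ if h : (j : ℕ) ≠ m + 1 then e j h (x k j) else 0) j₀ (u k))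
    (fun v ↦ Function.update 0 j₀ v.1)
  have hwl₀ : ∀ k : κ, w (inl k) j₀ = u k := fun k ↦ by
    simp only [w, elim_inl, Function.update_self]
  have hwl : ∀ (k : κ) (j : Fin (n + 1)) (h : (j : ℕ) ≠ m + 1), w (inl k) j = e j h (x k j) :=
    fun k j h ↦ by
      simp only [w, elim_inl]
      rw [Function.update_of_ne (fun h' ↦ h ((hj₀ j).2 h')), dif_pos h]
  have hwr₀ : ∀ v : T, w (inr v) j₀ = v := fun v ↦ Function.update_self ..
  have hwr : ∀ (v : T) (j : Fin (n + 1)), (j : ℕ) ≠ m + 1 → w (inr v) j = 0 :=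
    fun v j h ↦ Function.update_of_ne (fun h' ↦ h ((hj₀ j).2 h')) _ _
  refine ⟨T, (hBli.mono Set.subset_union_right).linearIndependent.setFinite, w,
    ?_, ?_, ?_, ?_, ?_, ?_, ?_⟩
  · rintro (k | v)
    · exact matchedLeft_le_matchedRight (hx.le k) k.2
    · exact le_rfl
  · have hmn : m + 2 ≤ n := hm
    rintro (k | v)
    · have : d k ≤ n := hx.le_top k
      simp only [elim_inl, matchedRight, Fin.val_last]
      split_ifs <;> omega
    · simp only [elim_inr, Fin.val_last]
      omega
  · rintro (k | v) j hj
    · by_cases h : (j : ℕ) = m + 1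
      · obtain rfl := (hj₀ j).1 h
        exact (hwl₀ k).trans (hκ0 k hj)
      · rw [hwl k j h, hx.zero k j, map_zero]
        simpa [matchedLeft_le_iff h, le_matchedRight_iff h] using hj
    · exact hwr v j fun h ↦ hj (by simp [h])
  · intro j _
    by_cases h : (j : ℕ) = m + 1
    · obtain rfl := (hj₀ j).1 h
      have hset : {k : κ ⊕ T | Sum.elim (fun k : κ ↦ matchedLeft (m + 1) (b k))
          (fun _ ↦ m + 1) k ≤ j₀ ∧ j₀ ≤ Sum.elim (fun k : κ ↦ matchedRight (m + 1) (d k))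
            (fun _ ↦ m + 1) k} = inl '' s ∪ Set.range inr := by
        ext (k | v) <;> simp [hs, j₀]
      rw [hset, LinearIndepOn_iff_linearIndepOn_image_injOn]
      constructor
      · rw [Set.image_union, Set.image_image, ← Set.range_comp]
        simpa [Function.comp_def, hwl₀, hwr₀] using hBli
      · rintro _ (⟨k, hk, rfl⟩ | ⟨v, rfl⟩) _ (⟨l, hl, rfl⟩ | ⟨v', rfl⟩) h <;>
          simp only [hwl₀, hwr₀] at h
        · rw [hκ_li.injOn hk hl h]
        · exact absurd v'.2 (Set.disjoint_left.1 hdisj (h ▸ ⟨k, hk, rfl⟩))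
        · exact absurd v.2 (Set.disjoint_left.1 hdisj (h ▸ ⟨l, hl, rfl⟩))
        · rw [Subtype.ext h]
    · have hset : {k : κ ⊕ T | Sum.elim (fun k : κ ↦ matchedLeft (m + 1) (b k))
          (fun _ ↦ m + 1) k ≤ j ∧ j ≤ Sum.elim (fun k : κ ↦ matchedRight (m + 1) (d k))
            (fun _ ↦ m + 1) k} = inl '' {k : κ | b k ≤ j ∧ j ≤ d k} := by
        ext (k | v)
        · simp [matchedLeft_le_iff h, le_matchedRight_iff h]
        · simp; omega
      rw [hset]
      refine LinearIndepOn.image_of_comp _ _ (LinearIndepOn.congr (v := e j h ∘ fun k : κ ↦ x k j)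
        ?_ fun k _ ↦ (hwl k j h).symm)
      refine LinearIndepOn.map_injOn ?_ (e j h).toLinearMap (e j h).injective.injOn
      exact LinearIndepOn.comp_of_image (f := Subtype.val) ((hx.li j (Fin.le_last j)).mono
        (by rintro _ ⟨k, hk, rfl⟩; exact hk)) Subtype.val_injective.injOn
  · intro j _
    by_cases h : (j : ℕ) = m + 1
    · obtain rfl := (hj₀ j).1 h
      rw [eq_top_iff, ← hBspan]
      refine Submodule.span_mono (Set.union_subset ?_ fun v hv ↦ ⟨inr ⟨v, hv⟩, hwr₀ _⟩)
      rintro _ ⟨k, -, rfl⟩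
      exact ⟨inl k, hwl₀ k⟩
    · have hmap := congrArg (Submodule.map (e j h).toLinearMap) (hx.span j (Fin.le_last j))
      rw [Submodule.map_top, LinearEquiv.range, Submodule.map_span] at hmap
      rw [eq_top_iff, ← hmap, Submodule.span_le]
      rintro _ ⟨_, ⟨k, rfl⟩, rfl⟩
      by_cases hk : b k = m + 1 ∧ d k = m + 1
      · have h0 : x k j = 0 := hx.zero k j (by omega)
        simp [h0]
      · exact Submodule.subset_span ⟨inl ⟨k, hk⟩, hwl _ j h⟩
  · rintro i ho - (k | v) hb hd
    · have hi : (i : ℕ) ≠ m + 1 := fun hi ↦ by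
        obtain rfl : i = ⟨m + 1, hm⟩ := Fin.ext hi
        simp [horC'] at ho
      simp only [elim_inl, matchedLeft_le_iff hi, le_matchedRight_iff hi] at hb hd
      by_cases him : (i : ℕ) = m
      · obtain rfl : i = ⟨m, Nat.lt_of_succ_lt hm⟩ := Fin.ext him
        refine Eq.trans ?_ (hwl₀ k).symm
        rw [hwl k _ (by simp), hul k ⟨hb, hd⟩]
        rfl
      · have ho' : orient i = true := hsame i him hi ▸ ho
        rw [hwl k _ hi, hwl k i.succ (by simpa using him),
          ← hx.fwd i ho' (Fin.le_last _) k hb hd, hcomm_fwd i him hi ho' ho]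
    · simp only [elim_inr] at hb hd
      obtain rfl : i = ⟨m + 1, hm⟩ := Fin.ext (le_antisymm hd hb)
      simp [horC'] at ho
  · rintro i ho - (k | v) hb hd
    · have him : (i : ℕ) ≠ m := fun hi ↦ by
        obtain rfl : i = ⟨m, Nat.lt_of_succ_lt hm⟩ := Fin.ext hi
        simp [horA'] at ho
      have him' : (i : ℕ) + 1 ≠ m + 1 := by omega
      simp only [elim_inl, matchedLeft_le_iff him', le_matchedRight_iff him'] at hb hd
      by_cases hi : (i : ℕ) = m + 1
      · obtain rfl : i = ⟨m + 1, hm⟩ := Fin.ext hi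
        refine Eq.trans ?_ (hwl₀ k).symm
        rw [hwl k _ (by simp), hur k ⟨hb, hd⟩]
        rfl
      · have ho' : orient i = false := hsame i him hi ▸ ho
        rw [hwl k i.castSucc hi, hwl k i.succ him',
          ← hx.bwd i ho' (Fin.le_last _) k hb hd, hcomm_bwd i him hi ho' ho]
    · simp only [elim_inr] at hb hd
      obtain rfl : i = ⟨m, Nat.lt_of_succ_lt hm⟩ := Fin.ext (by simp; omega)
      simp [horA'] at ho

/-- **Exact Diamond Principle.** Let `V` and `W` be representations agreeing everywhere
except at the index `i = m+1`, where `V` carries maps `a : V_i → V_{i-1}`,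
`c : V_i → V_{i+1}` and `W` carries maps `b : V_{i-1} → W_i`, `d : V_{i+1} → W_i`,
related by an exact diamond (`im D₁ = ker D₂` with `D₁ v = (a v, c v)`,
`D₂ (x,y) = b x - d y`). Then there are interval decompositions of `V` and `W` and a
partial bijection between them realizing the matching rule, the intervals `I[i;i]` on
either side being unmatched. -/
theorem exact_diamond_principle (F : Type) [Field F] (n m : ℕ) (hm : m + 1 < n)
    (orient orient' : Fin n → Bool)
    (horA : orient ⟨m, by omega⟩ = false) (horC : orient ⟨m + 1, hm⟩ = true)
    (horA' : orient' ⟨m, by omega⟩ = true) (horC' : orient' ⟨m + 1, hm⟩ = false)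
    (hsame : ∀ k : Fin n, (k : ℕ) ≠ m → (k : ℕ) ≠ m + 1 → orient' k = orient k)
    (VRep : ZigzagRep F n orient) (WRep : ZigzagRep F n orient')
    (hfdV : ∀ j, FiniteDimensional F (VRep.V j)) (hfdW : ∀ j, FiniteDimensional F (WRep.V j))
    (e : ∀ j : Fin (n + 1), (j : ℕ) ≠ m + 1 → (VRep.V j ≃ₗ[F] WRep.V j))
    (hcomm_fwd : ∀ (k : Fin n) (hk : (k : ℕ) ≠ m) (hk' : (k : ℕ) ≠ m + 1)
      (h : orient k = true) (h' : orient' k = true)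
      (hs : ((k.succ : Fin (n+1)) : ℕ) ≠ m + 1)
      (hc : ((k.castSucc : Fin (n+1)) : ℕ) ≠ m + 1) (x : VRep.V k.castSucc),
        e k.succ hs (VRep.fwd k h x) = WRep.fwd k h' (e k.castSucc hc x))
    (hcomm_bwd : ∀ (k : Fin n) (hk : (k : ℕ) ≠ m) (hk' : (k : ℕ) ≠ m + 1)
      (h : orient k = false) (h' : orient' k = false)
      (hs : ((k.succ : Fin (n+1)) : ℕ) ≠ m + 1)
      (hc : ((k.castSucc : Fin (n+1)) : ℕ) ≠ m + 1) (x : VRep.V k.succ),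
        e k.castSucc hc (VRep.bwd k h x) = WRep.bwd k h' (e k.succ hs x))
    (hexact :
      LinearMap.range
        (LinearMap.prod (VRep.bwd ⟨m, by omega⟩ horA) (VRep.fwd ⟨m + 1, hm⟩ horC))
      = LinearMap.ker
        (LinearMap.coprod
          ((WRep.fwd ⟨m, by omega⟩ horA') ∘ₗ
            (e (Fin.castSucc ⟨m, by omega⟩) (by simp)).toLinearMap)
          (-((WRep.bwd ⟨m + 1, hm⟩ horC') ∘ₗ
            (e (Fin.succ ⟨m + 1, hm⟩) (by simp)).toLinearMap)))) :
    ∃ (N : ℕ) (b d : Fin N → ℕ) (_ : ∀ k, b k ≤ d k ∧ d k ≤ n)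
      (_ : ZigzagRep.Iso VRep
        (ZigzagRep.dsum fun k : Fin N => intervalRep F n orient (b k) (d k)))
      (N' : ℕ) (b' d' : Fin N' → ℕ) (_ : ∀ k, b' k ≤ d' k ∧ d' k ≤ n)
      (_ : ZigzagRep.Iso WRep
        (ZigzagRep.dsum fun k : Fin N' => intervalRep F n orient' (b' k) (d' k)))
      (eqv : {k : Fin N // ¬(b k = m + 1 ∧ d k = m + 1)}
        ≃ {k' : Fin N' // ¬(b' k' = m + 1 ∧ d' k' = m + 1)}),
      ∀ k, matchedInterval (m + 1) (b k.1) (d k.1) (b' (eqv k).1) (d' (eqv k).1) := by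
  obtain ⟨N, b, d, x, hx⟩ := VRep.exists_isIntervalBasis
  obtain ⟨T, _, w, hw⟩ := hx.exists_of_exact_diamond hm horA horC horA' horC' hsame e
    hcomm_fwd hcomm_bwd hexact
  let σ := Finite.equivFin ({k // ¬(b k = m + 1 ∧ d k = m + 1)} ⊕ T)
  have hw' := hw.reindex σ.symm
  refine ⟨N, b, d, fun k ↦ ⟨hx.le k, hx.le_top k⟩, hx.iso, _, _, _,
    fun k ↦ ⟨hw'.le k, hw'.le_top k⟩, hw'.iso,
    Equiv.ofBijective (fun k ↦ ⟨σ (Sum.inl k), ?_⟩) ⟨fun k l hkl ↦ ?_, ?_⟩, fun k ↦ ?_⟩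
  · simpa using not_matched_eq (hx.le k)
  · exact Sum.inl_injective (σ.injective (congrArg Subtype.val hkl))
  · rintro ⟨k', hk'⟩
    obtain ⟨k | v, rfl⟩ := σ.surjective k'
    · exact ⟨k, rfl⟩
    · simp at hk'
  · change matchedInterval _ _ _ (Sum.elim _ _ (σ.symm (σ (Sum.inl k))))
      (Sum.elim _ _ (σ.symm (σ (Sum.inl k))))
    rw [Equiv.symm_apply_apply]
    exact matchedInterval_matched (hx.le k) k.2
end

section
/- Let V and W be zigzag modules related by a transposition diamond at index i with a injective of corank 1 and c surjective of nullity 1. Then V ≅ U ⊕ I[i;d] ⊕ I[b;i] and W ≅ U ⊕ I[i+1;d] ⊕ I[b;i−1] for some indices b ≤ i−1 ≤ i+1 ≤ d and a common module U. -/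
variable {F : Type} [Field F] {n : ℕ} {orient : Fin n → Bool}

section LinearAlgebra

variable {X Y : Type} [AddCommGroup X] [Module F X] [AddCommGroup Y] [Module F Y]

theorem exists_dual_eq_one_of_notMem {K : Submodule F X} {k : X} (hk : k ∉ K) :
    ∃ φ : X →ₗ[F] F, K ≤ LinearMap.ker φ ∧ φ k = 1 := by
  obtain ⟨φ, hφ, hK⟩ := Submodule.exists_le_ker_of_notMem hk
  refine ⟨(φ k)⁻¹ • φ, fun x hx => ?_, by simp [hφ]⟩
  have := hK hx
  simp_all

/-- A functional vanishing on the preimage of `K` extends along `f` to one vanishing on `K`. -/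
theorem exists_dual_comp_eq (f : X →ₗ[F] Y) (K : Submodule F Y) (ψ : X →ₗ[F] F)
    (hψ : K.comap f ≤ LinearMap.ker ψ) :
    ∃ φ : Y →ₗ[F] F, φ ∘ₗ f = ψ ∧ K ≤ LinearMap.ker φ := by
  have hmem : ψ ∈ LinearMap.range (K.mkQ ∘ₗ f).dualMap := by
    rw [LinearMap.range_dualMap_eq_dualAnnihilator_ker, Submodule.mem_dualAnnihilator]
    intro x hx
    exact hψ (by simpa using hx)
  obtain ⟨χ, hχ⟩ := hmem
  refine ⟨χ ∘ₗ K.mkQ, hχ, fun x hx => ?_⟩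
  simp [(Submodule.Quotient.mk_eq_zero K).2 hx]

theorem pull_step (f : X →ₗ[F] Y) {k : Y} {K : Submodule F Y} (hk : k ∉ K) :
    (∃ φ : Y →ₗ[F] F, K ≤ LinearMap.ker φ ∧ φ k = 1 ∧ φ ∘ₗ f = 0) ∨
    ∃ (v : X) (K' : Submodule F X), v ∉ K' ∧
      ∀ (w : X) (ψ : X →ₗ[F] F), w - v ∈ K' → K' ≤ LinearMap.ker ψ → ψ w = 1 →
        ∃ φ : Y →ₗ[F] F, f w - k ∈ K ∧ K ≤ LinearMap.ker φ ∧ φ (f w) = 1 ∧ φ ∘ₗ f = ψ := by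
  by_cases h : ∃ v, f v - k ∈ K
  · obtain ⟨v, hv⟩ := h
    refine Or.inr ⟨v, K.comap f, fun hv' => hk ?_, fun w ψ hw hψ h1 => ?_⟩
    · simpa using K.sub_mem (Submodule.mem_comap.1 hv') hv
    · obtain ⟨φ, hφ, hK⟩ := exists_dual_comp_eq f K ψ hψ
      refine ⟨φ, ?_, hK, ?_, hφ⟩
      · have := K.add_mem (Submodule.mem_comap.1 hw) hv
        simpa using this
      · rw [← h1, ← hφ, LinearMap.comp_apply]
  · have hk' : k ∉ LinearMap.range f ⊔ K := by
      rw [Submodule.mem_sup]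
      rintro ⟨_, ⟨v, rfl⟩, x, hx, rfl⟩
      exact h ⟨v, by simpa using K.neg_mem hx⟩
    obtain ⟨φ, hφ, h1⟩ := exists_dual_eq_one_of_notMem hk'
    refine Or.inl ⟨φ, le_sup_right.trans hφ, h1, ?_⟩
    ext x
    exact hφ (Submodule.mem_sup_left ⟨x, rfl⟩)

theorem push_step (g : Y →ₗ[F] X) {k : Y} {K : Submodule F Y} (hk : k ∉ K) :
    (∃ (y : Y) (φ : Y →ₗ[F] F), y - k ∈ K ∧ K ≤ LinearMap.ker φ ∧ φ y = 1 ∧ g y = 0) ∨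
    ∃ (v : X) (K' : Submodule F X), v ∉ K' ∧
      ∀ (w : X) (ψ : X →ₗ[F] F), w - v ∈ K' → K' ≤ LinearMap.ker ψ → ψ w = 1 →
        ∃ y : Y, y - k ∈ K ∧ K ≤ LinearMap.ker (ψ ∘ₗ g) ∧ (ψ ∘ₗ g) y = 1 ∧ g y = w := by
  by_cases h : g k ∈ K.map g
  · obtain ⟨x, hx, hgx⟩ := h
    obtain ⟨φ, hφ, h1⟩ := exists_dual_eq_one_of_notMem hk
    have hx0 : φ x = 0 := hφ hx
    exact Or.inl ⟨k - x, φ, by simpa using K.neg_mem hx, hφ, by simp [hx0, h1], by simp [hgx]⟩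
  · refine Or.inr ⟨g k, K.map g, h, fun w ψ hw hψ h1 => ?_⟩
    obtain ⟨x, hx, hgx⟩ := hw
    have hg : g (x + k) = w := by simp [hgx]
    exact ⟨x + k, by simpa using hx, fun y hy => hψ ⟨y, hy, rfl⟩, by simp [-map_add, hg, h1], hg⟩

end LinearAlgebra

namespace ZigzagRep

/-- The spaces of a representation with support in `[b, d]` have vectors `w` and functionals `φ`
pairing to `1` on `[b, d]`. -/
structure IsDualPair (A : ZigzagRep F n orient) (b d : ℕ) (w : ∀ j, A.V j)
    (φ : ∀ j, A.V j →ₗ[F] F) : Prop where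
  pair : ∀ j : Fin (n + 1), b ≤ j → (j : ℕ) ≤ d → φ j (w j) = 1
  vec_eq_zero : ∀ j : Fin (n + 1), ¬(b ≤ j ∧ (j : ℕ) ≤ d) → w j = 0
  dual_eq_zero : ∀ j : Fin (n + 1), ¬(b ≤ j ∧ (j : ℕ) ≤ d) → φ j = 0

/-- At the arrow `l`, the vectors `w` define a morphism from `I[b;d]` and the functionals `φ`
a morphism to `I[b;d]`. -/
structure Compat (A : ZigzagRep F n orient) (b d : ℕ) (w : ∀ j, A.V j)
    (φ : ∀ j, A.V j →ₗ[F] F) (l : Fin n) : Prop where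
  vec_fwd : ∀ h, b ≤ l → A.fwd l h (w l.castSucc) = w l.succ
  dual_fwd : ∀ h, (l : ℕ) + 1 ≤ d → φ l.succ ∘ₗ A.fwd l h = φ l.castSucc
  vec_bwd : ∀ h, (l : ℕ) + 1 ≤ d → A.bwd l h (w l.succ) = w l.castSucc
  dual_bwd : ∀ h, b ≤ l → φ l.castSucc ∘ₗ A.bwd l h = φ l.succ

section

variable {A : ZigzagRep F n orient} {b d : ℕ} {w : ∀ j, A.V j} {φ : ∀ j, A.V j →ₗ[F] F}

theorem IsDualPair.compat_of_lt (H : A.IsDualPair b d w φ) {l : Fin n} (hl : (l : ℕ) + 1 < b) :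
    A.Compat b d w φ l := by
  have h1 : ¬(b ≤ (l.castSucc : ℕ) ∧ (l.castSucc : ℕ) ≤ d) := by simp; omega
  have h2 : ¬(b ≤ (l.succ : ℕ) ∧ (l.succ : ℕ) ≤ d) := by simp; omega
  constructor <;> intros <;>
    simp [H.vec_eq_zero _ h1, H.vec_eq_zero _ h2, H.dual_eq_zero _ h1, H.dual_eq_zero _ h2]

theorem IsDualPair.compat_of_gt (H : A.IsDualPair b d w φ) {l : Fin n} (hl : d < (l : ℕ)) :
    A.Compat b d w φ l := by
  have h1 : ¬(b ≤ (l.castSucc : ℕ) ∧ (l.castSucc : ℕ) ≤ d) := by simp; omega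
  have h2 : ¬(b ≤ (l.succ : ℕ) ∧ (l.succ : ℕ) ≤ d) := by simp; omega
  constructor <;> intros <;>
    simp [H.vec_eq_zero _ h1, H.vec_eq_zero _ h2, H.dual_eq_zero _ h1, H.dual_eq_zero _ h2]

theorem isDualPair_single (p : Fin (n + 1)) {y : A.V p} {ψ : A.V p →ₗ[F] F} (h : ψ y = 1) :
    A.IsDualPair p p (Function.update (fun _ => 0) p y) (Function.update (fun _ => 0) p ψ) := by
  constructor
  · intro j h1 h2
    obtain rfl : j = p := Fin.ext (by omega)
    simpa using h
  all_goals
    intro j hj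
    rw [Function.update_of_ne]
    rintro rfl
    exact hj ⟨le_rfl, le_rfl⟩

theorem IsDualPair.update_right (H : A.IsDualPair b d w φ) (p : Fin (n + 1)) (hp : (p : ℕ) = d + 1)
    (hb : b ≤ p) {y : A.V p} {ψ : A.V p →ₗ[F] F} (h : ψ y = 1) :
    A.IsDualPair b p (Function.update w p y) (Function.update φ p ψ) := by
  constructor
  · intro j h1 h2
    rcases eq_or_ne j p with rfl | hj
    · simpa using h
    · rw [Function.update_of_ne hj, Function.update_of_ne hj]
      have : (j : ℕ) ≠ p := fun h => hj (Fin.ext h)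
      exact H.pair j h1 (by omega)
  all_goals
    intro j hj
    rw [Function.update_of_ne (by rintro rfl; exact hj ⟨hb, le_rfl⟩)]
  · exact H.vec_eq_zero j (by omega)
  · exact H.dual_eq_zero j (by omega)

theorem IsDualPair.update_left (H : A.IsDualPair b d w φ) (p : Fin (n + 1)) (hp : (p : ℕ) + 1 = b)
    (hd : (p : ℕ) ≤ d) {y : A.V p} {ψ : A.V p →ₗ[F] F} (h : ψ y = 1) :
    A.IsDualPair p d (Function.update w p y) (Function.update φ p ψ) := by
  constructor
  · intro j h1 h2
    rcases eq_or_ne j p with rfl | hj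
    · simpa using h
    · rw [Function.update_of_ne hj, Function.update_of_ne hj]
      have : (j : ℕ) ≠ p := fun h => hj (Fin.ext h)
      exact H.pair j (by omega) h2
  all_goals
    intro j hj
    rw [Function.update_of_ne (by rintro rfl; exact hj ⟨le_rfl, hd⟩)]
  · exact H.vec_eq_zero j (by omega)
  · exact H.dual_eq_zero j (by omega)

/-- Compatibility at `l` only involves the data at the two ends of `l`. -/
theorem Compat.update {b' d' : ℕ} {l : Fin n} (H : A.Compat b d w φ l) (p : Fin (n + 1))
    (h1 : l.castSucc ≠ p) (h2 : l.succ ≠ p) (hb : b' ≤ l → b ≤ l)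
    (hd : (l : ℕ) + 1 ≤ d' → (l : ℕ) + 1 ≤ d) (y : A.V p) (ψ : A.V p →ₗ[F] F) :
    A.Compat b' d' (Function.update w p y) (Function.update φ p ψ) l := by
  constructor <;> intro h h' <;> simp only [Function.update_of_ne h1, Function.update_of_ne h2]
  · exact H.vec_fwd h (hb h')
  · exact H.dual_fwd h (hd h')
  · exact H.vec_bwd h (hd h')
  · exact H.dual_bwd h (hb h')

theorem extend_right (l : Fin n) (hb : b ≤ l) (H : A.IsDualPair b l w φ)
    (hC : ∀ i : Fin n, (i : ℕ) ≠ l → A.Compat b l w φ i)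
    {y : A.V l.succ} {ψ : A.V l.succ →ₗ[F] F} (hy : ψ y = 1)
    (hf : ∀ h, A.fwd l h (w l.castSucc) = y ∧ ψ ∘ₗ A.fwd l h = φ l.castSucc)
    (hg : ∀ h, A.bwd l h y = w l.castSucc ∧ φ l.castSucc ∘ₗ A.bwd l h = ψ) :
    A.IsDualPair b (l + 1) (Function.update w l.succ y) (Function.update φ l.succ ψ) ∧
    ∀ i : Fin n, (i : ℕ) ≠ l + 1 →
      A.Compat b (l + 1) (Function.update w l.succ y) (Function.update φ l.succ ψ) i := by
  have H' := H.update_right l.succ (by simp) (by simp; omega) hy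
  refine ⟨H', fun i hi => ?_⟩
  rcases lt_trichotomy (i : ℕ) l with h | h | h
  · exact (hC i h.ne).update _ (by simp [Fin.ext_iff]; omega) (by simp [Fin.ext_iff]; omega)
      id (by omega) _ _
  · obtain rfl : i = l := Fin.ext h
    have hne : i.castSucc ≠ i.succ := by simp [Fin.ext_iff]
    constructor <;> intro h h' <;> simp only [Function.update_of_ne hne, Function.update_self]
    exacts [(hf h).1, (hf h).2, (hg h).1, (hg h).2]
  · exact H'.compat_of_gt (by simp; omega)

theorem extend_left (l : Fin n) (hd : (l : ℕ) + 1 ≤ d) (H : A.IsDualPair (l + 1) d w φ)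
    (hC : ∀ i : Fin n, (i : ℕ) ≠ l → A.Compat (l + 1) d w φ i)
    {y : A.V l.castSucc} {ψ : A.V l.castSucc →ₗ[F] F} (hy : ψ y = 1)
    (hf : ∀ h, A.fwd l h y = w l.succ ∧ φ l.succ ∘ₗ A.fwd l h = ψ)
    (hg : ∀ h, A.bwd l h (w l.succ) = y ∧ ψ ∘ₗ A.bwd l h = φ l.succ) :
    A.IsDualPair l d (Function.update w l.castSucc y) (Function.update φ l.castSucc ψ) ∧
    ∀ i : Fin n, (i : ℕ) + 1 ≠ l →
      A.Compat l d (Function.update w l.castSucc y) (Function.update φ l.castSucc ψ) i := by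
  have H' := H.update_left l.castSucc (by simp) (by simp; omega) hy
  refine ⟨H', fun i hi => ?_⟩
  rcases lt_trichotomy (i : ℕ) l with h | h | h
  · exact H'.compat_of_lt (by simp; omega)
  · obtain rfl : i = l := Fin.ext h
    have hne : i.succ ≠ i.castSucc := by simp [Fin.ext_iff]
    constructor <;> intro h h' <;> simp only [Function.update_of_ne hne, Function.update_self]
    exacts [(hf h).1, (hf h).2, (hg h).1, (hg h).2]
  · exact (hC i h.ne').update _ (by simp [Fin.ext_iff]; omega) (by simp [Fin.ext_iff]; omega)
      (by omega) id _ _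

end

variable (A : ZigzagRep F n orient)

theorem step_right (l : Fin n) {k : A.V l.succ} {K : Submodule F (A.V l.succ)} (hk : k ∉ K) :
    (∃ (y : A.V l.succ) (φ : A.V l.succ →ₗ[F] F), y - k ∈ K ∧ K ≤ LinearMap.ker φ ∧ φ y = 1 ∧
      (∀ h, φ ∘ₗ A.fwd l h = 0) ∧ ∀ h, A.bwd l h y = 0) ∨
    ∃ (v : A.V l.castSucc) (K' : Submodule F (A.V l.castSucc)), v ∉ K' ∧
      ∀ (w : A.V l.castSucc) (ψ : A.V l.castSucc →ₗ[F] F), w - v ∈ K' →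
        K' ≤ LinearMap.ker ψ → ψ w = 1 →
        ∃ (y : A.V l.succ) (φ : A.V l.succ →ₗ[F] F), y - k ∈ K ∧ K ≤ LinearMap.ker φ ∧ φ y = 1 ∧
          (∀ h, A.fwd l h w = y ∧ φ ∘ₗ A.fwd l h = ψ) ∧
          ∀ h, A.bwd l h y = w ∧ ψ ∘ₗ A.bwd l h = φ := by
  rcases (Bool.eq_false_or_eq_true (orient l)).symm with ho | ho
  · rcases push_step (A.bwd l ho) hk with ⟨y, φ, h1, h2, h3, h4⟩ | ⟨v, K', hv, H⟩
    · exact Or.inl ⟨y, φ, h1, h2, h3, by simp [ho], fun _ => h4⟩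
    · refine Or.inr ⟨v, K', hv, fun w ψ hw hψ h => ?_⟩
      obtain ⟨y, h1, h2, h3, h4⟩ := H w ψ hw hψ h
      exact ⟨y, _, h1, h2, h3, by simp [ho], fun _ => ⟨h4, rfl⟩⟩
  · rcases pull_step (A.fwd l ho) hk with ⟨φ, h1, h2, h3⟩ | ⟨v, K', hv, H⟩
    · exact Or.inl ⟨k, φ, by simp, h1, h2, fun _ => h3, by simp [ho]⟩
    · refine Or.inr ⟨v, K', hv, fun w ψ hw hψ h => ?_⟩
      obtain ⟨φ, h1, h2, h3, h4⟩ := H w ψ hw hψ h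
      exact ⟨_, φ, h1, h2, h3, fun _ => ⟨rfl, h4⟩, by simp [ho]⟩

theorem step_left (l : Fin n) {k : A.V l.castSucc} {K : Submodule F (A.V l.castSucc)}
    (hk : k ∉ K) :
    (∃ (y : A.V l.castSucc) (φ : A.V l.castSucc →ₗ[F] F), y - k ∈ K ∧ K ≤ LinearMap.ker φ ∧
      φ y = 1 ∧ (∀ h, A.fwd l h y = 0) ∧ ∀ h, φ ∘ₗ A.bwd l h = 0) ∨
    ∃ (v : A.V l.succ) (K' : Submodule F (A.V l.succ)), v ∉ K' ∧
      ∀ (w : A.V l.succ) (ψ : A.V l.succ →ₗ[F] F), w - v ∈ K' →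
        K' ≤ LinearMap.ker ψ → ψ w = 1 →
        ∃ (y : A.V l.castSucc) (φ : A.V l.castSucc →ₗ[F] F), y - k ∈ K ∧
          K ≤ LinearMap.ker φ ∧ φ y = 1 ∧
          (∀ h, A.fwd l h y = w ∧ ψ ∘ₗ A.fwd l h = φ) ∧
          ∀ h, A.bwd l h w = y ∧ φ ∘ₗ A.bwd l h = ψ := by
  rcases (Bool.eq_false_or_eq_true (orient l)).symm with ho | ho
  · rcases pull_step (A.bwd l ho) hk with ⟨φ, h1, h2, h3⟩ | ⟨v, K', hv, H⟩
    · exact Or.inl ⟨k, φ, by simp, h1, h2, by simp [ho], fun _ => h3⟩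
    · refine Or.inr ⟨v, K', hv, fun w ψ hw hψ h => ?_⟩
      obtain ⟨φ, h1, h2, h3, h4⟩ := H w ψ hw hψ h
      exact ⟨_, φ, h1, h2, h3, by simp [ho], fun _ => ⟨rfl, h4⟩⟩
  · rcases push_step (A.fwd l ho) hk with ⟨y, φ, h1, h2, h3, h4⟩ | ⟨v, K', hv, H⟩
    · exact Or.inl ⟨y, φ, h1, h2, h3, fun _ => h4, by simp [ho]⟩
    · refine Or.inr ⟨v, K', hv, fun w ψ hw hψ h => ?_⟩
      obtain ⟨y, h1, h2, h3, h4⟩ := H w ψ hw hψ h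
      exact ⟨y, _, h1, h2, h3, fun _ => ⟨h4, rfl⟩, by simp [ho]⟩

/-- Up to the vertex `p`, an interval ending at `p` splits off through a vector of `k + K`,
with a complement containing `K`. -/
theorem exists_interval_ending_at (p : Fin (n + 1)) :
    ∀ (k : A.V p) (K : Submodule F (A.V p)), k ∉ K →
      ∃ (b : ℕ) (w : ∀ j, A.V j) (φ : ∀ j, A.V j →ₗ[F] F), b ≤ p ∧ w p - k ∈ K ∧
        K ≤ LinearMap.ker (φ p) ∧ A.IsDualPair b p w φ ∧
        ∀ i : Fin n, (i : ℕ) ≠ p → A.Compat b p w φ i := by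
  induction p using Fin.induction with
  | zero =>
    intro k K hk
    obtain ⟨φ, hK, h1⟩ := exists_dual_eq_one_of_notMem hk
    have H := isDualPair_single 0 h1
    refine ⟨0, _, _, le_rfl, ?_, ?_, H, fun i hi => H.compat_of_gt (by simp at hi ⊢; omega)⟩
    · simp
    · simpa using hK
  | succ l ih =>
    intro k K hk
    rcases A.step_right l hk with ⟨y, ψ, h1, h2, h3, h4, h5⟩ | ⟨v, K', hv, Hstep⟩
    · have H := isDualPair_single l.succ h3
      refine ⟨_, _, _, le_rfl, ?_, ?_, H, fun i hi => ?_⟩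
      · simpa using h1
      · simpa using h2
      · rcases lt_trichotomy (i : ℕ) l with h | h | h
        · exact H.compat_of_lt (by simp; omega)
        · obtain rfl : i = l := Fin.ext h
          have hne : i.castSucc ≠ i.succ := by simp [Fin.ext_iff]
          constructor <;> intro h h' <;>
            simp only [Function.update_of_ne hne, Function.update_self]
          exacts [by simp at h', h4 h, h5 h, by simp at h']
        · exact H.compat_of_gt (by simp at hi ⊢; omega)
    · obtain ⟨b, w, φ, hb, hw, hK', H, hC⟩ := ih v K' hv
      obtain ⟨y, ψ, h1, h2, h3, h4, h5⟩ := Hstep _ _ hw hK' (H.pair _ hb le_rfl)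
      obtain ⟨H', hC'⟩ := extend_right l hb H hC h3 h4 h5
      refine ⟨b, _, _, ?_, ?_, ?_, H', hC'⟩
      · simp at hb ⊢; omega
      · simpa using h1
      · simpa using h2

/-- From the vertex `p` on, an interval starting at `p` splits off through a vector of `k + K`,
with a complement containing `K`. -/
theorem exists_interval_starting_at (p : Fin (n + 1)) :
    ∀ (k : A.V p) (K : Submodule F (A.V p)), k ∉ K →
      ∃ (d : ℕ) (w : ∀ j, A.V j) (φ : ∀ j, A.V j →ₗ[F] F), (p : ℕ) ≤ d ∧ d ≤ n ∧ w p - k ∈ K ∧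
        K ≤ LinearMap.ker (φ p) ∧ A.IsDualPair p d w φ ∧
        ∀ i : Fin n, (i : ℕ) + 1 ≠ p → A.Compat p d w φ i := by
  induction p using Fin.reverseInduction with
  | last =>
    intro k K hk
    obtain ⟨φ, hK, h1⟩ := exists_dual_eq_one_of_notMem hk
    have H := isDualPair_single (Fin.last n) h1
    refine ⟨n, _, _, by simp, le_rfl, ?_, ?_, H, fun i hi => H.compat_of_lt ?_⟩
    · simp
    · simpa using hK
    · simp at hi ⊢; omega
  | cast l ih =>
    intro k K hk
    rcases A.step_left l hk with ⟨y, ψ, h1, h2, h3, h4, h5⟩ | ⟨v, K', hv, Hstep⟩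
    · have H := isDualPair_single l.castSucc h3
      refine ⟨_, _, _, le_rfl, l.castSucc.is_le, ?_, ?_, H, fun i hi => ?_⟩
      · simpa using h1
      · simpa using h2
      · rcases lt_trichotomy (i : ℕ) l with h | h | h
        · exact H.compat_of_lt (by simp at hi ⊢; omega)
        · obtain rfl : i = l := Fin.ext h
          have hne : i.succ ≠ i.castSucc := by simp [Fin.ext_iff]
          constructor <;> intro h h' <;>
            simp only [Function.update_of_ne hne, Function.update_self]
          exacts [h4 h, by simp at h', by simp at h', h5 h]
        · exact H.compat_of_gt (by simp; omega)
    · obtain ⟨d, w, φ, hd, hdn, hw, hK', H, hC⟩ := ih v K' hv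
      obtain ⟨y, ψ, h1, h2, h3, h4, h5⟩ := Hstep _ _ hw hK' (H.pair _ le_rfl hd)
      obtain ⟨H', hC'⟩ := extend_left l hd H (fun i hi => hC i (by simpa using hi)) h3 h4 h5
      refine ⟨d, _, _, ?_, hdn, ?_, ?_, H', hC'⟩
      · simp at hd ⊢; omega
      · simpa using h1
      · simpa using h2

/-- The vectors `w` define a morphism from `I[b;d]`. -/
structure IsIntervalMap (b d : ℕ) (w : ∀ j, A.V j) : Prop where
  vec_eq_zero : ∀ j : Fin (n + 1), ¬(b ≤ j ∧ (j : ℕ) ≤ d) → w j = 0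
  vec_fwd : ∀ (l : Fin n) h, b ≤ (l : ℕ) → A.fwd l h (w l.castSucc) = w l.succ
  vec_bwd : ∀ (l : Fin n) h, (l : ℕ) + 1 ≤ d → A.bwd l h (w l.succ) = w l.castSucc

variable {A}

theorem IsDualPair.isIntervalMap {b d : ℕ} {w : ∀ j, A.V j} {φ : ∀ j, A.V j →ₗ[F] F}
    (H : A.IsDualPair b d w φ) (hC : ∀ l, A.Compat b d w φ l) : A.IsIntervalMap b d w where
  vec_eq_zero := H.vec_eq_zero
  vec_fwd l := (hC l).vec_fwd
  vec_bwd l := (hC l).vec_bwd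

theorem _root_.intervalSp_of_mem {b d i : ℕ} (h : b ≤ i ∧ i ≤ d) : intervalSp F b d i = ⊤ :=
  if_pos h

theorem _root_.intervalSp_of_notMem {b d i : ℕ} (h : ¬(b ≤ i ∧ i ≤ d)) :
    intervalSp F b d i = ⊥ :=
  if_neg h

theorem _root_.intervalSp_coe_eq_zero {b d i : ℕ} (h : ¬(b ≤ i ∧ i ≤ d))
    (y : intervalSp F b d i) : (y : F) = 0 := by
  simpa using (intervalSp_of_notMem h).le y.2

theorem IsIntervalMap.fwd_smul {b d : ℕ} {w : ∀ j, A.V j} (H : A.IsIntervalMap b d w) (l : Fin n)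
    (h : orient l = true) (y : intervalSp F b d l) :
    A.fwd l h ((y : F) • w l.castSucc) =
      (intervalSp F b d (l + 1)).subtype ((intervalRep F n orient b d).fwd l h y) • w l.succ := by
  have h1 : A.fwd l h ((y : F) • w l.castSucc) = (y : F) • w l.succ := by
    by_cases hb : b ≤ l
    · rw [map_smul, H.vec_fwd l h hb]
    · simp [intervalSp_coe_eq_zero (fun h' => hb h'.1) y]
  rw [h1]
  by_cases hl : b ≤ (l : ℕ) + 1 ∧ (l : ℕ) + 1 ≤ d
  · have hle : intervalSp F b d l ≤ intervalSp F b d (l + 1) := by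
      rw [intervalSp_of_mem hl]
      exact le_top
    simp only [intervalRep, dif_pos hle]
    rfl
  · rw [H.vec_eq_zero l.succ (by simpa using hl), smul_zero, smul_zero]

theorem IsIntervalMap.bwd_smul {b d : ℕ} {w : ∀ j, A.V j} (H : A.IsIntervalMap b d w) (l : Fin n)
    (h : orient l = false) (y : intervalSp F b d (l + 1)) :
    A.bwd l h ((y : F) • w l.succ) =
      (intervalSp F b d l).subtype ((intervalRep F n orient b d).bwd l h y) • w l.castSucc := by
  have h1 : A.bwd l h ((y : F) • w l.succ) = (y : F) • w l.castSucc := by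
    by_cases hd : (l : ℕ) + 1 ≤ d
    · rw [map_smul, H.vec_bwd l h hd]
    · simp [intervalSp_coe_eq_zero (fun h' => hd h'.2) y]
  rw [h1]
  by_cases hl : b ≤ (l : ℕ) ∧ (l : ℕ) ≤ d
  · have hle : intervalSp F b d (l + 1) ≤ intervalSp F b d l := by
      rw [intervalSp_of_mem hl]
      exact le_top
    simp only [intervalRep, dif_pos hle]
    rfl
  · rw [H.vec_eq_zero l.castSucc (by simpa using hl), smul_zero, smul_zero]

/-- A morphism `ι` and two interval maps that jointly decompose every space of `A` give a
decomposition of `A`. -/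
theorem nonempty_iso_prod {U : ZigzagRep F n orient} (ι : ∀ j, U.V j →ₗ[F] A.V j)
    (hf : ∀ l h x, A.fwd l h (ι l.castSucc x) = ι l.succ (U.fwd l h x))
    (hb : ∀ l h x, A.bwd l h (ι l.succ x) = ι l.castSucc (U.bwd l h x))
    {b₁ d₁ b₂ d₂ : ℕ} {w₁ w₂ : ∀ j, A.V j} (H₁ : A.IsIntervalMap b₁ d₁ w₁)
    (H₂ : A.IsIntervalMap b₂ d₂ w₂)
    (hinj : ∀ (j : Fin (n + 1)) (u : U.V j) (s t : F),
      (¬(b₁ ≤ j ∧ (j : ℕ) ≤ d₁) → s = 0) → (¬(b₂ ≤ j ∧ (j : ℕ) ≤ d₂) → t = 0) →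
      ι j u + (s • w₁ j + t • w₂ j) = 0 → u = 0 ∧ s = 0 ∧ t = 0)
    (hsurj : ∀ (j : Fin (n + 1)) (x : A.V j), ∃ (u : U.V j) (s t : F),
      (¬(b₁ ≤ j ∧ (j : ℕ) ≤ d₁) → s = 0) ∧ (¬(b₂ ≤ j ∧ (j : ℕ) ≤ d₂) → t = 0) ∧
      ι j u + (s • w₁ j + t • w₂ j) = x) :
    Nonempty (Iso A (U.prod ((intervalRep F n orient b₁ d₁).prod
      (intervalRep F n orient b₂ d₂)))) := by
  let T (j : Fin (n + 1)) :
      (U.V j × (intervalSp F b₁ d₁ j × intervalSp F b₂ d₂ j)) →ₗ[F] A.V j :=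
    (ι j).coprod (((LinearMap.toSpanSingleton F _ (w₁ j)) ∘ₗ (intervalSp F b₁ d₁ j).subtype).coprod
      ((LinearMap.toSpanSingleton F _ (w₂ j)) ∘ₗ (intervalSp F b₂ d₂ j).subtype))
  have hT : ∀ j u y z, T j (u, (y, z)) = ι j u + ((y : F) • w₁ j + (z : F) • w₂ j) :=
    fun j u y z => by simp [T]
  have hbij : ∀ j, Function.Bijective (T j) := by
    refine fun j => ⟨?_, fun x => ?_⟩
    · rw [injective_iff_map_eq_zero]
      rintro ⟨u, y, z⟩ h
      rw [hT] at h
      obtain ⟨h1, h2, h3⟩ := hinj j u y z (fun h' => intervalSp_coe_eq_zero h' y)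
        (fun h' => intervalSp_coe_eq_zero h' z) h
      ext1
      · exact h1
      · exact Prod.ext (Subtype.ext h2) (Subtype.ext h3)
    · obtain ⟨u, s, t, hs, ht, hx⟩ := hsurj j x
      have mem : ∀ {b d : ℕ} {s : F}, (¬(b ≤ j ∧ (j : ℕ) ≤ d) → s = 0) →
          s ∈ intervalSp F b d j := by
        intro b d s hs
        by_cases h : b ≤ (j : ℕ) ∧ (j : ℕ) ≤ d
        · simp [intervalSp_of_mem h]
        · simp [hs h]
      exact ⟨(u, (⟨s, mem hs⟩, ⟨t, mem ht⟩)), by rw [hT]; exact hx⟩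
  let E j := LinearEquiv.ofBijective (T j) (hbij j)
  have key_fwd : ∀ l h u y z, A.fwd l h (T l.castSucc (u, (y, z))) = T l.succ (U.fwd l h u,
      ((intervalRep F n orient b₁ d₁).fwd l h y, (intervalRep F n orient b₂ d₂).fwd l h z)) := by
    intro l h u y z
    refine ((congrArg _ (hT _ u y z)).trans ?_).trans (hT _ _ _ _).symm
    exact (map_add _ _ _).trans (congrArg₂ (· + ·) (hf l h u) ((map_add _ _ _).trans
      (congrArg₂ (· + ·) (H₁.fwd_smul l h y) (H₂.fwd_smul l h z))))
  have key_bwd : ∀ l h u y z, A.bwd l h (T l.succ (u, (y, z))) = T l.castSucc (U.bwd l h u,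
      ((intervalRep F n orient b₁ d₁).bwd l h y, (intervalRep F n orient b₂ d₂).bwd l h z)) := by
    intro l h u y z
    refine ((congrArg _ (hT _ u y z)).trans ?_).trans (hT _ _ _ _).symm
    exact (map_add _ _ _).trans (congrArg₂ (· + ·) (hb l h u) ((map_add _ _ _).trans
      (congrArg₂ (· + ·) (H₁.bwd_smul l h y) (H₂.bwd_smul l h z))))
  refine ⟨⟨fun j => (E j).symm, fun l h x => ?_, fun l h x => ?_⟩⟩
  · exact (E l.succ).symm_apply_eq.2 ((congrArg (A.fwd l h)
      ((E l.castSucc).apply_symm_apply x).symm).trans (key_fwd l h _ _ _))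
  · exact (E l.castSucc).symm_apply_eq.2 ((congrArg (A.bwd l h)
      ((E l.succ).apply_symm_apply x).symm).trans (key_bwd l h _ _ _))

/-- The subrepresentation on a compatible family of subspaces. -/
def ofSubmodules (S : ∀ j, Submodule F (A.V j))
    (hf : ∀ (l : Fin n) h, ∀ x ∈ S l.castSucc, A.fwd l h x ∈ S l.succ)
    (hb : ∀ (l : Fin n) h, ∀ x ∈ S l.succ, A.bwd l h x ∈ S l.castSucc) : ZigzagRep F n orient where
  V j := S j
  fwd l h := (A.fwd l h).restrict (hf l h)
  bwd l h := (A.bwd l h).restrict (hb l h)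

theorem IsDualPair.fwd_mem_ker {b d : ℕ} {w : ∀ j, A.V j} {φ : ∀ j, A.V j →ₗ[F] F}
    (H : A.IsDualPair b d w φ) {l : Fin n} (hC : A.Compat b d w φ l) (h : orient l = true)
    {x : A.V l.castSucc} (hx : φ l.castSucc x = 0) : φ l.succ (A.fwd l h x) = 0 := by
  by_cases hl : (l : ℕ) + 1 ≤ d
  · rw [← LinearMap.comp_apply, hC.dual_fwd h hl, hx]
  · rw [H.dual_eq_zero l.succ (by simp; omega), LinearMap.zero_apply]

theorem IsDualPair.bwd_mem_ker {b d : ℕ} {w : ∀ j, A.V j} {φ : ∀ j, A.V j →ₗ[F] F}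
    (H : A.IsDualPair b d w φ) {l : Fin n} (hC : A.Compat b d w φ l) (h : orient l = false)
    {x : A.V l.succ} (hx : φ l.succ x = 0) : φ l.castSucc (A.bwd l h x) = 0 := by
  by_cases hl : b ≤ l
  · rw [← LinearMap.comp_apply, hC.dual_bwd h hl, hx]
  · rw [H.dual_eq_zero l.castSucc (by simp; omega), LinearMap.zero_apply]

end ZigzagRep

/-- The linear algebra of an exact square whose sides `a` and `c` are injective of corank one and
surjective of nullity one. -/
theorem exact_square_facts {P Q R S : Type} [AddCommGroup P] [Module F P] [AddCommGroup Q]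
    [Module F Q] [AddCommGroup R] [Module F R] [AddCommGroup S] [Module F S]
    [FiniteDimensional F Q]
    (a : P →ₗ[F] Q) (b : P →ₗ[F] S) (c : Q →ₗ[F] R) (d : S →ₗ[F] R)
    (hexact : LinearMap.range (a.prod b) = LinearMap.ker (c.coprod (-d)))
    (ha : Function.Injective a) (hcorank : Module.finrank F Q = Module.finrank F P + 1)
    (hc : Function.Surjective c) (hnull : Module.finrank F (LinearMap.ker c) = 1) :
    (∀ x, c (a x) = d (b x)) ∧ Function.Injective d ∧ Function.Surjective b ∧
    (∃ k, k ≠ 0 ∧ c (a k) = 0 ∧ ∀ x, c x = 0 → ∃ t : F, x = t • a k) ∧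
    ∃ z, c z ∉ LinearMap.range d ∧ ∀ x, ∃ (v : P) (t : F), x = a v + t • z := by
  have hcomm : ∀ x, c (a x) = d (b x) := fun x => by
    have : a.prod b x ∈ LinearMap.ker (c.coprod (-d)) := hexact ▸ ⟨x, rfl⟩
    simpa [← sub_eq_add_neg, sub_eq_zero] using this
  have hlift : ∀ x y, c x = d y → ∃ v, a v = x ∧ b v = y := fun x y h => by
    have : (x, y) ∈ LinearMap.range (a.prod b) := by rw [hexact]; simp [h]
    obtain ⟨v, hv⟩ := this
    exact ⟨v, by simpa using hv⟩
  have hd : Function.Injective d := by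
    rw [injective_iff_map_eq_zero]
    intro y hy
    obtain ⟨v, hv, rfl⟩ := hlift 0 y (by simp [hy])
    rw [ha (hv.trans (map_zero a).symm), map_zero]
  have hb : Function.Surjective b := fun y => by
    obtain ⟨x, hx⟩ := hc (d y)
    obtain ⟨v, -, hv⟩ := hlift x y hx
    exact ⟨v, hv⟩
  have hker : ∀ x, c x = 0 → ∃ v, a v = x := fun x hx => by
    obtain ⟨v, hv, -⟩ := hlift x 0 (by simp [hx])
    exact ⟨v, hv⟩
  refine ⟨hcomm, hd, hb, ?_, ?_⟩
  · obtain ⟨⟨x, hx⟩, hx0, hx'⟩ := finrank_eq_one_iff'.1 hnull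
    obtain ⟨k, rfl⟩ := hker x hx
    refine ⟨k, ?_, hx, fun y hy => ?_⟩
    · rintro rfl
      exact hx0 (Subtype.ext (map_zero a))
    · obtain ⟨t, ht⟩ := hx' ⟨y, hy⟩
      exact ⟨t, (congrArg Subtype.val ht).symm⟩
  · have hq : Module.finrank F (Q ⧸ LinearMap.range a) = 1 := by
      have h1 := Submodule.finrank_quotient_add_finrank (LinearMap.range a)
      rw [LinearMap.finrank_range_of_inj ha] at h1
      omega
    obtain ⟨q, hq0, hq'⟩ := finrank_eq_one_iff'.1 hq
    obtain ⟨z, rfl⟩ := Submodule.Quotient.mk_surjective _ q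
    refine ⟨z, ?_, fun x => ?_⟩
    · rintro ⟨y, hy⟩
      obtain ⟨v, hv, -⟩ := hlift z y hy.symm
      exact hq0 ((Submodule.Quotient.mk_eq_zero _).2 ⟨v, hv⟩)
    · obtain ⟨t, ht⟩ := hq' (Submodule.Quotient.mk x)
      rw [← Submodule.Quotient.mk_smul, Submodule.Quotient.eq] at ht
      obtain ⟨v, hv⟩ := ht
      exact ⟨-v, t, by rw [map_neg, hv]; abel⟩

namespace ZigzagRep

/-- The two intervals ending, respectively starting, in the middle of `V_m → V_{m+1} → V_{m+2}`,
as direct summands. -/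
theorem exists_split (A : ZigzagRep F n orient) (m : ℕ) (hm : m + 1 < n)
    (h0 : m < n + 1) (h1 : m + 1 < n + 1) (h2 : m + 2 < n + 1)
    (hA : orient ⟨m, Nat.lt_of_succ_lt hm⟩ = true) (hC : orient ⟨m + 1, hm⟩ = true)
    (a : A.V ⟨m, h0⟩ →ₗ[F] A.V ⟨m + 1, h1⟩)
    (c : A.V ⟨m + 1, h1⟩ →ₗ[F] A.V ⟨m + 2, h2⟩)
    (hadef : a = A.fwd ⟨m, Nat.lt_of_succ_lt hm⟩ hA) (hcdef : c = A.fwd ⟨m + 1, hm⟩ hC)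
    (ha : Function.Injective a) (hc : Function.Surjective c)
    (K : Submodule F (A.V ⟨m + 2, h2⟩)) (hK : ∀ x, c (a x) ∈ K)
    (k : A.V ⟨m, h0⟩) (hk : k ≠ 0) (hck : c (a k) = 0)
    (z : A.V ⟨m + 1, h1⟩) (hz : c z ∉ K) (hspan : ∀ x, ∃ v, ∃ t : F, x = a v + t • z) :
    ∃ (b d : ℕ) (w₁ w₂ : ∀ j, A.V j) (φ₁ φ₂ : ∀ j, A.V j →ₗ[F] F),
      b ≤ m ∧ m + 2 ≤ d ∧ d ≤ n ∧
      A.IsDualPair (m + 1) d w₁ φ₁ ∧ (∀ l, A.Compat (m + 1) d w₁ φ₁ l) ∧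
      A.IsDualPair b (m + 1) w₂ φ₂ ∧ (∀ l, A.Compat b (m + 1) w₂ φ₂ l) ∧
      (∀ j, φ₁ j (w₂ j) = 0) ∧ (∀ j, φ₂ j (w₁ j) = 0) ∧
      w₂ ⟨m, h0⟩ = k ∧ LinearMap.ker (φ₁ ⟨m + 2, h2⟩) = K := by
  have hmn : m < n := by omega
  obtain ⟨b, w₂, φ₂, hb, hw₂, -, H₂, C₂⟩ :=
    A.exists_interval_ending_at ⟨m, h0⟩ k ⊥ (by simpa using hk)
  obtain ⟨d, w₁, φ₁, hd, hdn, hw₁, hφ₁, H₁, C₁⟩ :=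
    A.exists_interval_starting_at ⟨m + 2, h2⟩ (c z) K hz
  replace hw₂ : w₂ ⟨m, h0⟩ = k := by simpa [sub_eq_zero] using hw₂
  simp only at hb hd H₁ H₂ C₁ C₂
  obtain ⟨y, hy⟩ := hc (w₁ ⟨m + 2, h2⟩)
  have hp₁ : φ₁ ⟨m + 2, h2⟩ (c y) = 1 := by rw [hy]; exact H₁.pair _ le_rfl hd
  have hcz : φ₁ ⟨m + 2, h2⟩ (c z) = 1 := by
    have := hφ₁ hw₁
    rw [LinearMap.mem_ker, map_sub, ← hy, hp₁, sub_eq_zero] at this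
    exact this.symm
  have hker : LinearMap.ker (φ₁ ⟨m + 2, h2⟩) = K := by
    refine le_antisymm (fun x hx => ?_) hφ₁
    obtain ⟨x, rfl⟩ := hc x
    obtain ⟨v, t, rfl⟩ := hspan x
    have h0 : φ₁ ⟨m + 2, h2⟩ (c (a v)) = 0 := hφ₁ (hK v)
    rw [LinearMap.mem_ker, map_add, map_add, h0, map_smul, map_smul, hcz] at hx
    have ht : t = 0 := by simpa using hx
    simpa [ht] using hK v
  obtain ⟨ψ, hψ, hψy⟩ := exists_dual_comp_eq a (Submodule.span F {y}) (φ₂ ⟨m, h0⟩) (by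
    intro x hx
    obtain ⟨t, ht⟩ := Submodule.mem_span_singleton.1 (Submodule.mem_comap.1 hx)
    have h0 : φ₁ ⟨m + 2, h2⟩ (c (a x)) = 0 := hφ₁ (hK x)
    rw [← ht, map_smul, map_smul, hp₁, smul_eq_mul, mul_one] at h0
    rw [h0, zero_smul] at ht
    rw [ha (ht.symm.trans (map_zero a).symm)]
    exact Submodule.zero_mem _)
  have hψy0 : ψ y = 0 := hψy (Submodule.mem_span_singleton_self y)
  have hpk : φ₂ ⟨m, h0⟩ k = 1 := by rw [← hw₂]; exact H₂.pair _ hb le_rfl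
  have hψk : ψ (a k) = 1 := by rw [← LinearMap.comp_apply, hψ, hpk]
  obtain ⟨H₂', C₂'⟩ := extend_right (⟨m, hmn⟩ : Fin n) hb H₂ C₂ (y := a k) (ψ := ψ) hψk
    (fun h => ⟨by rw [hadef, ← hw₂]; rfl, by subst hadef; exact hψ⟩)
    (fun h => by simp [hA] at h)
  obtain ⟨H₁', C₁'⟩ := extend_left (⟨m + 1, hm⟩ : Fin n) (by simp; omega) H₁
    (fun i hi => C₁ i (by simp at hi ⊢; omega)) (y := y) (ψ := φ₁ ⟨m + 2, h2⟩ ∘ₗ c)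
    (by simpa using hp₁)
    (fun h => ⟨by rw [← hcdef]; exact hy, by rw [hcdef]; rfl⟩)
    (fun h => by simp [hC] at h)
  have hw₂m : Function.update w₂ (Fin.succ ⟨m, hmn⟩) (a k) ⟨m, h0⟩ = k := by
    rw [Function.update_of_ne (by simp [Fin.ext_iff]), hw₂]
  have hw₂m' : Function.update w₂ (Fin.succ ⟨m, hmn⟩) (a k) ⟨m + 1, h1⟩ = a k :=
    Function.update_self ..
  have hφ₂m' : Function.update φ₂ (Fin.succ ⟨m, hmn⟩) ψ ⟨m + 1, h1⟩ = ψ :=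
    Function.update_self ..
  have hw₁m : Function.update w₁ (Fin.castSucc ⟨m + 1, hm⟩) y ⟨m + 1, h1⟩ = y :=
    Function.update_self ..
  have hφ₁m : Function.update φ₁ (Fin.castSucc ⟨m + 1, hm⟩) (φ₁ ⟨m + 2, h2⟩ ∘ₗ c)
      ⟨m + 1, h1⟩ = φ₁ ⟨m + 2, h2⟩ ∘ₗ c :=
    Function.update_self ..
  have hφ₁m' : Function.update φ₁ (Fin.castSucc ⟨m + 1, hm⟩) (φ₁ ⟨m + 2, h2⟩ ∘ₗ c)
      ⟨m + 2, h2⟩ = φ₁ ⟨m + 2, h2⟩ := by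
    rw [Function.update_of_ne (by simp [Fin.ext_iff])]
  simp only at H₁' C₁' H₂' C₂'
  refine ⟨b, d, _, _, _, _, hb, hd, hdn, H₁', fun l => ?_, H₂', fun l => ?_, fun j => ?_,
    fun j => ?_, hw₂m, by rw [hφ₁m', hker]⟩
  · by_cases hl : (l : ℕ) + 1 = m + 1
    · obtain rfl : l = ⟨m, hmn⟩ := Fin.ext (by simpa using hl)
      refine ⟨fun h h' => ?_, fun h h' => ?_, fun h => by simp [hA] at h,
        fun h => by simp [hA] at h⟩
      · simp at h'
      · ext x
        rw [H₁'.dual_eq_zero (Fin.castSucc ⟨m, _⟩) (by simp)]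
        have h0 : φ₁ ⟨m + 2, h2⟩ (c (a x)) = 0 := hφ₁ (hK x)
        rw [hadef] at h0
        change Function.update φ₁ (Fin.castSucc ⟨m + 1, hm⟩) (φ₁ ⟨m + 2, h2⟩ ∘ₗ c)
          ⟨m + 1, h1⟩ _ = 0
        rw [hφ₁m]
        exact h0
    · exact C₁' l hl
  · by_cases hl : (l : ℕ) = m + 1
    · obtain rfl : l = ⟨m + 1, hm⟩ := Fin.ext hl
      refine ⟨fun h h' => ?_, fun h h' => ?_, fun h => by simp [hC] at h,
        fun h => by simp [hC] at h⟩
      · rw [H₂'.vec_eq_zero (Fin.succ ⟨m + 1, hm⟩) (by simp)]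
        change A.fwd _ h (Function.update w₂ (Fin.succ ⟨m, hmn⟩) (a k) ⟨m + 1, h1⟩) = 0
        rw [hw₂m', ← hcdef, hck]
      · simp at h'
    · exact C₂' l hl
  · rcases lt_trichotomy (j : ℕ) (m + 1) with h | h | h
    · rw [H₁'.dual_eq_zero j (by omega), LinearMap.zero_apply]
    · obtain rfl : j = ⟨m + 1, h1⟩ := Fin.ext h
      rw [hφ₁m, hw₂m', LinearMap.comp_apply, hck, map_zero]
    · rw [H₂'.vec_eq_zero j (by omega), map_zero]
  · rcases lt_trichotomy (j : ℕ) (m + 1) with h | h | h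
    · rw [H₁'.vec_eq_zero j (by omega), map_zero]
    · obtain rfl : j = ⟨m + 1, h1⟩ := Fin.ext h
      rw [hφ₂m', hw₁m, hψy0]
    · rw [H₂'.dual_eq_zero j (by omega), LinearMap.zero_apply]

theorem IsDualPair.eq_zero_of_add_eq_zero {A : ZigzagRep F n orient} {b₁ d₁ b₂ d₂ : ℕ}
    {w₁ w₂ : ∀ j, A.V j} {φ₁ φ₂ : ∀ j, A.V j →ₗ[F] F} (H₁ : A.IsDualPair b₁ d₁ w₁ φ₁)
    (H₂ : A.IsDualPair b₂ d₂ w₂ φ₂) {j : Fin (n + 1)} (h₁₂ : φ₁ j (w₂ j) = 0)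
    (h₂₁ : φ₂ j (w₁ j) = 0) {u : A.V j} (hu₁ : φ₁ j u = 0) (hu₂ : φ₂ j u = 0) {s t : F}
    (hs : ¬(b₁ ≤ j ∧ (j : ℕ) ≤ d₁) → s = 0) (ht : ¬(b₂ ≤ j ∧ (j : ℕ) ≤ d₂) → t = 0)
    (h : u + (s • w₁ j + t • w₂ j) = 0) : u = 0 ∧ s = 0 ∧ t = 0 := by
  have hs0 : s = 0 := by
    by_cases hj : b₁ ≤ (j : ℕ) ∧ (j : ℕ) ≤ d₁
    · simpa [hu₁, h₁₂, H₁.pair j hj.1 hj.2] using congrArg (φ₁ j) h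
    · exact hs hj
  have ht0 : t = 0 := by
    by_cases hj : b₂ ≤ (j : ℕ) ∧ (j : ℕ) ≤ d₂
    · simpa [hu₂, h₂₁, H₂.pair j hj.1 hj.2] using congrArg (φ₂ j) h
    · exact ht hj
  exact ⟨by simpa [hs0, ht0] using h, hs0, ht0⟩

theorem IsDualPair.exists_eq_add {A : ZigzagRep F n orient} {b₁ d₁ b₂ d₂ : ℕ}
    {w₁ w₂ : ∀ j, A.V j} {φ₁ φ₂ : ∀ j, A.V j →ₗ[F] F} (H₁ : A.IsDualPair b₁ d₁ w₁ φ₁)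
    (H₂ : A.IsDualPair b₂ d₂ w₂ φ₂) {j : Fin (n + 1)} (h₁₂ : φ₁ j (w₂ j) = 0)
    (h₂₁ : φ₂ j (w₁ j) = 0) (x : A.V j) :
    ∃ (u : A.V j) (s t : F), φ₁ j u = 0 ∧ φ₂ j u = 0 ∧
      (¬(b₁ ≤ j ∧ (j : ℕ) ≤ d₁) → s = 0) ∧ (¬(b₂ ≤ j ∧ (j : ℕ) ≤ d₂) → t = 0) ∧
      u + (s • w₁ j + t • w₂ j) = x := by
  refine ⟨x - (φ₁ j x • w₁ j + φ₂ j x • w₂ j), φ₁ j x, φ₂ j x, ?_, ?_, fun hj => ?_, fun hj => ?_,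
    sub_add_cancel _ _⟩
  · by_cases hj : b₁ ≤ (j : ℕ) ∧ (j : ℕ) ≤ d₁
    · simp [h₁₂, H₁.pair j hj.1 hj.2]
    · simp [H₁.dual_eq_zero j hj]
  · by_cases hj : b₂ ≤ (j : ℕ) ∧ (j : ℕ) ≤ d₂
    · simp [h₂₁, H₂.pair j hj.1 hj.2]
    · simp [H₂.dual_eq_zero j hj]
  · simp [H₁.dual_eq_zero j hj]
  · simp [H₂.dual_eq_zero j hj]

theorem exists_extend_family {A B : ZigzagRep F n orient} {p : ℕ}
    (e : ∀ j : Fin (n + 1), (j : ℕ) ≠ p → (A.V j ≃ₗ[F] B.V j)) (hp : p < n + 1)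
    (g : A.V ⟨p, hp⟩ →ₗ[F] B.V ⟨p, hp⟩) :
    ∃ T : ∀ j, A.V j →ₗ[F] B.V j, (∀ j h, T j = (e j h).toLinearMap) ∧ T ⟨p, hp⟩ = g := by
  have hex : ∀ j : Fin (n + 1), ∃ T : A.V j →ₗ[F] B.V j,
      (∀ h, T = (e j h).toLinearMap) ∧ ∀ h : j = ⟨p, hp⟩, T = h ▸ g := by
    intro j
    by_cases h : (j : ℕ) = p
    · obtain rfl : j = ⟨p, hp⟩ := Fin.ext h
      exact ⟨g, fun h' => absurd h h', fun _ => rfl⟩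
    · exact ⟨e j h, fun _ => rfl, fun h' => absurd (congrArg Fin.val h') h⟩
  choose T hT hT' using hex
  exact ⟨T, hT, hT' _ rfl⟩

end ZigzagRep

/-- **Transposition Diamond Principle, mixed case.** Let `V` and `W` be zigzag modules
related by a transposition diamond at index `i = m+1` (exactness `im D₁ = ker D₂` with
`D₁ v = (a v, b v)`, `D₂ (x,y) = c x - d y`), with `a : V_{i-1} → V_i` injective of
corank 1 and `c : V_i → V_{i+1}` surjective of nullity 1. Then
`V ≅ U ⊕ I[i;d] ⊕ I[b;i]` and `W ≅ U ⊕ I[i+1;d] ⊕ I[b;i-1]` for some indices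
`b ≤ i-1` and `d ≥ i+1`, with a common summand `U`. -/
theorem transposition_diamond_mixed (F : Type) [Field F] (n m : ℕ)
    (hm : m + 1 < n) (orient : Fin n → Bool)
    (horA : orient ⟨m, by omega⟩ = true) (horC : orient ⟨m + 1, hm⟩ = true)
    (VRep WRep : ZigzagRep F n orient)
    (hfdV : ∀ j, FiniteDimensional F (VRep.V j)) (hfdW : ∀ j, FiniteDimensional F (WRep.V j))
    (e : ∀ j : Fin (n + 1), (j : ℕ) ≠ m + 1 → (VRep.V j ≃ₗ[F] WRep.V j))
    (hcomm_fwd : ∀ (k : Fin n) (hk : (k : ℕ) ≠ m) (hk' : (k : ℕ) ≠ m + 1)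
      (h : orient k = true)
      (hs : ((k.succ : Fin (n+1)) : ℕ) ≠ m + 1)
      (hc : ((k.castSucc : Fin (n+1)) : ℕ) ≠ m + 1) (x : VRep.V k.castSucc),
        e k.succ hs (VRep.fwd k h x) = WRep.fwd k h (e k.castSucc hc x))
    (hcomm_bwd : ∀ (k : Fin n) (hk : (k : ℕ) ≠ m) (hk' : (k : ℕ) ≠ m + 1)
      (h : orient k = false)
      (hs : ((k.succ : Fin (n+1)) : ℕ) ≠ m + 1)
      (hc : ((k.castSucc : Fin (n+1)) : ℕ) ≠ m + 1) (x : VRep.V k.succ),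
        e k.castSucc hc (VRep.bwd k h x) = WRep.bwd k h (e k.succ hs x))
    (hexact :
      LinearMap.range
        (LinearMap.prod (VRep.fwd ⟨m, by omega⟩ horA)
          ((WRep.fwd ⟨m, by omega⟩ horA) ∘ₗ
            (e (Fin.castSucc ⟨m, by omega⟩) (by simp)).toLinearMap))
      = LinearMap.ker
        (LinearMap.coprod (VRep.fwd ⟨m + 1, hm⟩ horC)
          (-((e (Fin.succ ⟨m + 1, hm⟩) (by simp)).symm.toLinearMap ∘ₗ
              WRep.fwd ⟨m + 1, hm⟩ horC))))
    (hainj : Function.Injective (VRep.fwd ⟨m, by omega⟩ horA))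
    (hacorank : Module.finrank F (VRep.V (Fin.succ ⟨m, by omega⟩))
      = Module.finrank F (VRep.V (Fin.castSucc ⟨m, by omega⟩)) + 1)
    (hcsurj : Function.Surjective (VRep.fwd ⟨m + 1, hm⟩ horC))
    (hcnull : Module.finrank F (LinearMap.ker (VRep.fwd ⟨m + 1, hm⟩ horC)) = 1) :
    ∃ (bb dd : ℕ) (_ : bb ≤ m) (_ : m + 2 ≤ dd) (_ : dd ≤ n)
      (U : ZigzagRep F n orient),
      Nonempty (ZigzagRep.Iso VRep
        (ZigzagRep.prod U
          (ZigzagRep.prod (intervalRep F n orient (m + 1) dd)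
            (intervalRep F n orient bb (m + 1))))) ∧
      Nonempty (ZigzagRep.Iso WRep
        (ZigzagRep.prod U
          (ZigzagRep.prod (intervalRep F n orient (m + 2) dd)
            (intervalRep F n orient bb m)))) := by
  have h0 : m < n + 1 := by omega
  have h1 : m + 1 < n + 1 := by omega
  have h2 : m + 2 < n + 1 := by omega
  have hmn : m < n := by omega
  have hm0 : m ≠ m + 1 := by omega
  have hm2 : m + 2 ≠ m + 1 := by omega
  let a : VRep.V ⟨m, h0⟩ →ₗ[F] VRep.V ⟨m + 1, h1⟩ := VRep.fwd ⟨m, hmn⟩ horA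
  let c : VRep.V ⟨m + 1, h1⟩ →ₗ[F] VRep.V ⟨m + 2, h2⟩ := VRep.fwd ⟨m + 1, hm⟩ horC
  let bW : WRep.V ⟨m, h0⟩ →ₗ[F] WRep.V ⟨m + 1, h1⟩ := WRep.fwd ⟨m, hmn⟩ horA
  let dW : WRep.V ⟨m + 1, h1⟩ →ₗ[F] WRep.V ⟨m + 2, h2⟩ := WRep.fwd ⟨m + 1, hm⟩ horC
  let b : VRep.V ⟨m, h0⟩ →ₗ[F] WRep.V ⟨m + 1, h1⟩ := bW ∘ₗ (e ⟨m, h0⟩ hm0).toLinearMap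
  let d : WRep.V ⟨m + 1, h1⟩ →ₗ[F] VRep.V ⟨m + 2, h2⟩ :=
    (e ⟨m + 2, h2⟩ hm2).symm.toLinearMap ∘ₗ dW
  have hdW : ∀ y, dW y = e ⟨m + 2, h2⟩ hm2 (d y) := fun y =>
    ((e ⟨m + 2, h2⟩ hm2).apply_symm_apply _).symm
  have : FiniteDimensional F (VRep.V ⟨m + 1, h1⟩) := hfdV _
  obtain ⟨hcomm, hd, hb, ⟨k, hk0, hck, hkerc⟩, z, hz, hspan⟩ :=
    exact_square_facts a b c d hexact hainj hacorank hcsurj hcnull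
  obtain ⟨bb, dd, w₁, w₂, φ₁, φ₂, hbb, hdd, hddn, H₁, C₁, H₂, C₂, h₁₂, h₂₁, hw₂, hker⟩ :=
    VRep.exists_split m hm h0 h1 h2 horA horC a c rfl rfl hainj hcsurj (LinearMap.range d)
      (fun x => ⟨b x, (hcomm x).symm⟩) k hk0 hck z hz hspan
  have hφ₁ : ∀ x, φ₁ ⟨m + 1, h1⟩ x = φ₁ ⟨m + 2, h2⟩ (c x) := fun x =>
    (LinearMap.congr_fun ((C₁ ⟨m + 1, hm⟩).dual_fwd horC hdd) x).symm
  have hw₂' : w₂ ⟨m + 1, h1⟩ = a k := by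
    rw [← hw₂]
    exact ((C₂ ⟨m, hmn⟩).vec_fwd horA hbb).symm
  have hφ₂k : φ₂ ⟨m + 1, h1⟩ (a k) = 1 := by
    rw [← hw₂']
    exact H₂.pair _ (hbb.trans (Nat.le_succ m)) le_rfl
  have hφ₁k : φ₁ ⟨m + 1, h1⟩ (a k) = 0 := by rw [← hw₂', h₁₂]
  have hbk : b k = 0 := hd (by rw [← hcomm, hck, map_zero])
  -- `r` retracts `d`, so `r ∘ c` identifies the common summand at the two middle vertices
  obtain ⟨r, hr⟩ := LinearMap.exists_leftInverse_of_injective d (LinearMap.ker_eq_bot.2 hd)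
  replace hr : ∀ y, r (d y) = y := LinearMap.congr_fun hr
  have hdr : ∀ x, φ₁ ⟨m + 1, h1⟩ x = 0 → d (r (c x)) = c x := fun x hx => by
    rw [hφ₁, ← LinearMap.mem_ker, hker] at hx
    obtain ⟨y, hy⟩ := hx
    rw [← hy, hr]
  obtain ⟨T, hT, hTm⟩ := ZigzagRep.exists_extend_family e h1 (r ∘ₗ c)
  have hTm' : ∀ x, T ⟨m + 1, h1⟩ x = r (c x) := LinearMap.congr_fun hTm
  have hTf : ∀ (l : Fin n) h, (l : ℕ) ≠ m → (l : ℕ) ≠ m + 1 → ∀ x,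
      WRep.fwd l h (T l.castSucc x) = T l.succ (VRep.fwd l h x) := fun l h hl hl' x => by
    rw [hT l.castSucc (by simpa using hl'), hT l.succ (by simpa using hl)]
    exact (hcomm_fwd l hl hl' h _ _ x).symm
  have hTb : ∀ (l : Fin n) h, (l : ℕ) ≠ m → (l : ℕ) ≠ m + 1 → ∀ x,
      WRep.bwd l h (T l.succ x) = T l.castSucc (VRep.bwd l h x) := fun l h hl hl' x => by
    rw [hT l.castSucc (by simpa using hl'), hT l.succ (by simpa using hl)]
    exact (hcomm_bwd l hl hl' h _ _ x).symm
  have hne : ∀ l : Fin n, orient l = false → (l : ℕ) ≠ m ∧ (l : ℕ) ≠ m + 1 := by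
    refine fun l h => ⟨fun hl => ?_, fun hl => ?_⟩
    · obtain rfl : l = ⟨m, hmn⟩ := Fin.ext hl
      simp [horA] at h
    · obtain rfl : l = ⟨m + 1, hm⟩ := Fin.ext hl
      simp [horC] at h
  let U : ZigzagRep F n orient := ZigzagRep.ofSubmodules (A := VRep)
    (fun j => LinearMap.ker (φ₁ j) ⊓ LinearMap.ker (φ₂ j))
    (fun l h x hx => ⟨H₁.fwd_mem_ker (C₁ l) h hx.1, H₂.fwd_mem_ker (C₂ l) h hx.2⟩)
    (fun l h x hx => ⟨H₁.bwd_mem_ker (C₁ l) h hx.1, H₂.bwd_mem_ker (C₂ l) h hx.2⟩)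
  let ι (j : Fin (n + 1)) : U.V j →ₗ[F] VRep.V j :=
    (LinearMap.ker (φ₁ j) ⊓ LinearMap.ker (φ₂ j)).subtype
  have hι₁ : ∀ j u, φ₁ j (ι j u) = 0 := fun j u => u.2.1
  have hι₂ : ∀ j u, φ₂ j (ι j u) = 0 := fun j u => u.2.2
  have hι : ∀ j u, ι j u = 0 → u = 0 := fun j u h => Subtype.ext h
  have hιf : ∀ l h x, VRep.fwd l h (ι l.castSucc x) = ι l.succ (U.fwd l h x) := fun _ _ _ => rfl
  have hιb : ∀ l h x, VRep.bwd l h (ι l.succ x) = ι l.castSucc (U.bwd l h x) := fun _ _ _ => rfl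
  have hιsurj : ∀ j x, φ₁ j x = 0 → φ₂ j x = 0 → ∃ u, ι j u = x := fun j x hx hx' =>
    ⟨⟨x, hx, hx'⟩, rfl⟩
  clear_value ι U
  refine ⟨bb, dd, hbb, hdd, hddn, U, ?_, ?_⟩
  · refine ZigzagRep.nonempty_iso_prod ι hιf hιb (H₁.isIntervalMap C₁) (H₂.isIntervalMap C₂)
      (fun j u s t hs ht h => ?_) (fun j x => ?_)
    · obtain ⟨hu, hs, ht⟩ :=
        H₁.eq_zero_of_add_eq_zero H₂ (h₁₂ j) (h₂₁ j) (hι₁ j u) (hι₂ j u) hs ht h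
      exact ⟨hι j u hu, hs, ht⟩
    · obtain ⟨u, s, t, hu₁, hu₂, hs, ht, h⟩ := H₁.exists_eq_add H₂ (h₁₂ j) (h₂₁ j) x
      obtain ⟨u, rfl⟩ := hιsurj j u hu₁ hu₂
      exact ⟨u, s, t, hs, ht, h⟩
  · let W' (w : ∀ j, VRep.V j) (j : Fin (n + 1)) : WRep.V j :=
      if (j : ℕ) = m + 1 then 0 else T j (w j)
    have hW' : ∀ w (j : Fin (n + 1)), (j : ℕ) ≠ m + 1 → W' w j = T j (w j) := fun w j hj => if_neg hj
    have hW'0 : ∀ w (j : Fin (n + 1)), (j : ℕ) = m + 1 → W' w j = 0 := fun w j hj => if_pos hj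
    clear_value W'
    have I₁ : WRep.IsIntervalMap (m + 2) dd (W' w₁) := by
      refine ⟨fun j hj => ?_, fun l h hl => ?_, fun l h hl => ?_⟩
      · by_cases hj' : (j : ℕ) = m + 1
        · exact hW'0 _ _ hj'
        · rw [hW' _ _ hj', H₁.vec_eq_zero j (by omega), map_zero]
      · rw [hW' _ _ (by simp; omega), hW' _ _ (by simp; omega),
          hTf l h (by omega) (by omega), (C₁ l).vec_fwd h (by omega)]
      · obtain ⟨hl1, hl2⟩ := hne l h
        rw [hW' _ _ (by simpa using hl1), hW' _ _ (by simpa using hl2),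
          hTb l h hl1 hl2, (C₁ l).vec_bwd h hl]
    have I₂ : WRep.IsIntervalMap bb m (W' w₂) := by
      refine ⟨fun j hj => ?_, fun l h hl => ?_, fun l h hl => ?_⟩
      · by_cases hj' : (j : ℕ) = m + 1
        · exact hW'0 _ _ hj'
        · rw [hW' _ _ hj', H₂.vec_eq_zero j (by omega), map_zero]
      · by_cases hl1 : (l : ℕ) = m
        · obtain rfl : l = ⟨m, hmn⟩ := Fin.ext hl1
          rw [hW'0 _ (Fin.succ ⟨m, hmn⟩) rfl, hW' _ (Fin.castSucc ⟨m, hmn⟩) hm0,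
            hT (Fin.castSucc ⟨m, hmn⟩) hm0]
          change b (w₂ ⟨m, h0⟩) = 0
          rw [hw₂, hbk]
        · by_cases hl2 : (l : ℕ) = m + 1
          · rw [hW'0 _ _ (by simpa using hl2), hW' _ _ (by simpa using hl1),
              H₂.vec_eq_zero _ (by simp; omega), map_zero, map_zero]
          · rw [hW' _ _ (by simpa using hl2), hW' _ _ (by simpa using hl1),
              hTf l h hl1 hl2, (C₂ l).vec_fwd h hl]
      · obtain ⟨hl1, hl2⟩ := hne l h
        rw [hW' _ _ (by simpa using hl1), hW' _ _ (by simpa using hl2),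
          hTb l h hl1 hl2, (C₂ l).vec_bwd h (by omega)]
    refine ZigzagRep.nonempty_iso_prod (fun j => T j ∘ₗ ι j) (fun l h x => ?_) (fun l h x => ?_)
      I₁ I₂ (fun j u s t hs ht h => ?_) (fun j x => ?_)
    · rw [LinearMap.comp_apply, LinearMap.comp_apply, ← hιf]
      by_cases hl1 : (l : ℕ) = m
      · obtain rfl : l = ⟨m, hmn⟩ := Fin.ext hl1
        rw [hT (Fin.castSucc ⟨m, hmn⟩) hm0]
        change b (ι ⟨m, h0⟩ x) = T ⟨m + 1, h1⟩ (a (ι ⟨m, h0⟩ x))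
        rw [hTm', hcomm, hr]
      · by_cases hl2 : (l : ℕ) = m + 1
        · obtain rfl : l = ⟨m + 1, hm⟩ := Fin.ext hl2
          rw [hT (Fin.succ ⟨m + 1, hm⟩) hm2]
          change dW (T ⟨m + 1, h1⟩ (ι ⟨m + 1, h1⟩ x)) =
            e ⟨m + 2, h2⟩ hm2 (c (ι ⟨m + 1, h1⟩ x))
          rw [hTm', hdW, hdr _ (hι₁ ⟨m + 1, h1⟩ x)]
        · exact hTf l h hl1 hl2 _
    · obtain ⟨hl1, hl2⟩ := hne l h
      rw [LinearMap.comp_apply, LinearMap.comp_apply, ← hιb]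
      exact hTb l h hl1 hl2 _
    · by_cases hj : (j : ℕ) = m + 1
      · obtain rfl : j = ⟨m + 1, h1⟩ := Fin.ext hj
        have hs0 := hs (by simp)
        have ht0 := ht (by simp)
        refine ⟨?_, hs0, ht0⟩
        rw [hs0, ht0, zero_smul, zero_smul, add_zero, add_zero, LinearMap.comp_apply, hTm'] at h
        have hcu : c (ι _ u) = 0 := by
          rw [← hdr _ (hι₁ _ u)]
          exact (congrArg d h).trans (map_zero d)
        obtain ⟨x, hx⟩ := hkerc _ hcu
        have hx0 := hι₂ _ u
        rw [hx, map_smul, hφ₂k, smul_eq_mul, mul_one] at hx0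
        exact hι _ u (by rw [hx, hx0, zero_smul])
      · rw [hW' _ _ hj, hW' _ _ hj, LinearMap.comp_apply, ← map_smul, ← map_smul, ← map_add,
          ← map_add, hT j hj, LinearEquiv.coe_coe, LinearEquiv.map_eq_zero_iff] at h
        obtain ⟨hu, hs, ht⟩ := H₁.eq_zero_of_add_eq_zero H₂ (h₁₂ j) (h₂₁ j) (hι₁ j u) (hι₂ j u)
          (fun h' => hs (by omega)) (fun h' => ht (by omega)) h
        exact ⟨hι j u hu, hs, ht⟩
    · by_cases hj : (j : ℕ) = m + 1
      · obtain rfl : j = ⟨m + 1, h1⟩ := Fin.ext hj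
        obtain ⟨v, rfl⟩ := hb x
        have hv₁ : φ₁ ⟨m + 1, h1⟩ (a v) = 0 := by
          rw [hφ₁, hcomm, ← LinearMap.mem_ker, hker]
          exact ⟨_, rfl⟩
        obtain ⟨u, hu⟩ := hιsurj ⟨m + 1, h1⟩ (a v - φ₂ ⟨m + 1, h1⟩ (a v) • a k)
          (by simp [hv₁, hφ₁k]) (by simp [hφ₂k])
        refine ⟨u, 0, 0, fun _ => rfl, fun _ => rfl, ?_⟩
        rw [zero_smul, zero_smul, add_zero, add_zero, LinearMap.comp_apply, hu, hTm',
          map_sub, map_smul, hck, smul_zero, sub_zero, hcomm, hr]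
      · obtain ⟨x, rfl⟩ := (e j hj).surjective x
        obtain ⟨u, s, t, hu₁, hu₂, hs, ht, h⟩ := H₁.exists_eq_add H₂ (h₁₂ j) (h₂₁ j) x
        obtain ⟨u, rfl⟩ := hιsurj j u hu₁ hu₂
        refine ⟨u, s, t, fun h' => hs (by omega), fun h' => ht (by omega), ?_⟩
        rw [hW' _ _ hj, hW' _ _ hj, LinearMap.comp_apply, ← map_smul, ← map_smul, ← map_add,
          ← map_add, hT j hj, h]
        rfl
end
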